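/- arXiv:2601.03999 — 2 statements merged into one kernel-verified Lean document; each statement's English description precedes it below -/
import Mathlib

section
/- Let (X,ν,T) be a measure-preserving system and let f ∈ L¹(X,ν). Then there exists a set X_f ⊆ X of full ν-measure such that for every θ ∈ [0,2π] and every x ∈ X_f, the averages (2N+1)^{−1} Σ_{n=−N}^{N} e(θn) f(Tⁿx) converge as N → ∞. -/
open MeasureTheory Filter Set
open scoped ENNReal NNReal


namespace WW
set_option linter.unusedSectionVars false
variable {X : Type*} [MeasurableSpace X]

/-- running maxima of Garsia -/
noncomputable def mx (T : X → X) (g : X → ℝ) : ℕ → X → ℝ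
  | 0 => fun _ => 0
  | N + 1 => fun x => max 0 (g x + mx T g N (T x))

lemma mx_nonneg (T : X → X) (g : X → ℝ) (N : ℕ) (x : X) : 0 ≤ mx T g N x := by
  cases N with
  | zero => simp [mx]
  | succ N => simp [mx]

lemma mx_mono (T : X → X) (g : X → ℝ) (N : ℕ) : ∀ x, mx T g N x ≤ mx T g (N + 1) x := by
  induction N with
  | zero => intro x; simp [mx]
  | succ N ih =>
    intro x
    have h := ih (T x)
    show max 0 (g x + mx T g N (T x)) ≤ max 0 (g x + mx T g (N + 1) (T x))
    exact max_le_max le_rfl (by linarith)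

lemma sum_le_mx (T : X → X) (g : X → ℝ) (N : ℕ) :
    ∀ x, ∑ n ∈ Finset.range N, g (T^[n] x) ≤ mx T g N x := by
  induction N with
  | zero => intro x; simp [mx]
  | succ N ih =>
    intro x
    rw [Finset.sum_range_succ']
    have h := ih (T x)
    have : g x + mx T g N (T x) ≤ mx T g (N + 1) x := le_max_right _ _
    simp only [Function.iterate_succ_apply, Function.iterate_zero, id]
    linarith

lemma mx_integrable {ν : Measure X} {T : X → X} (hT : MeasurePreserving T ν ν) {g : X → ℝ}
    (hg : Integrable g ν) (N : ℕ) : Integrable (mx T g N) ν := by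
  induction N with
  | zero => exact integrable_zero _ _ _
  | succ N ih =>
    have h1 : Integrable (fun x => mx T g N (T x)) ν := hT.integrable_comp_of_integrable ih
    have := (integrable_zero X ℝ ν).sup (hg.add h1)
    exact this

lemma max_ineq {ν : Measure X} [IsProbabilityMeasure ν] {T : X → X}
    (hT : MeasurePreserving T ν ν) {f : X → ℝ} (hf : Integrable f ν) (hf0 : ∀ x, 0 ≤ f x)
    {c : ℝ} (hc : 0 < c) :
    ν {x | ∃ N : ℕ, c * N < ∑ n ∈ Finset.range N, f (T^[n] x)} ≤
      ENNReal.ofReal ((∫ x, f x ∂ν) / c) := by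
  set g : X → ℝ := fun x => f x - c with hgdef
  have hg : Integrable g ν := hf.sub (integrable_const c)
  have hM := fun N => mx_integrable hT hg N
  have key : ∀ N, ν {x | 0 < mx T g N x} ≤ ENNReal.ofReal ((∫ x, f x ∂ν) / c) := by
    intro N
    cases N with
    | zero => simp [mx]
    | succ N =>
      have hMT : Integrable (fun x => mx T g N (T x)) ν :=
        hT.integrable_comp_of_integrable (hM N)
      have hMTi : ∫ x, mx T g N (T x) ∂ν = ∫ x, mx T g N x ∂ν := by
        have h := integral_map (μ := ν) hT.measurable.aemeasurable (f := mx T g N)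
          (by rw [hT.map_eq]; exact (hM N).aestronglyMeasurable)
        rw [hT.map_eq] at h
        exact h.symm
      set R : X → ℝ := fun x => f x - mx T g (N + 1) x + mx T g N (T x) with hR
      have hRi : Integrable R ν := (hf.sub (hM (N + 1))).add hMT
      have hRint : ∫ x, R x ∂ν ≤ ∫ x, f x ∂ν := by
        have e : ∫ x, R x ∂ν = ∫ x, f x ∂ν - ∫ x, mx T g (N + 1) x ∂ν
            + ∫ x, mx T g N (T x) ∂ν := by
          have e1 := integral_add (hf.sub (hM (N+1))) hMT
          have e2 := integral_sub hf (hM (N+1))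
          simp only [Pi.sub_apply] at e1
          rw [e2] at e1
          exact e1
        have : ∫ x, mx T g N x ∂ν ≤ ∫ x, mx T g (N + 1) x ∂ν :=
          integral_mono (hM N) (hM (N+1)) (mx_mono T g N)
        rw [e, hMTi]; linarith
      have hpt : ∀ x, 0 < mx T g (N + 1) x → c ≤ R x := by
        intro x hx
        have : mx T g (N + 1) x = max 0 (g x + mx T g N (T x)) := rfl
        have h2 : mx T g (N + 1) x = g x + mx T g N (T x) := by
          rw [this] at hx ⊢
          rcases lt_max_iff.1 hx with h | h
          · exact absurd h (lt_irrefl _)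
          · exact max_eq_right h.le
        simp only [hR, hgdef] at h2 ⊢; linarith
      have hR0 : ∀ x, 0 ≤ R x := by
        intro x
        rcases (mx_nonneg T g (N + 1) x).lt_or_eq with h | h
        · exact hc.le.trans (hpt x h)
        · have h1 := hf0 x
          have h2 := mx_nonneg T g N (T x)
          simp only [hR, ← h]; linarith
      have hmk := mul_meas_ge_le_integral_of_nonneg (μ := ν) (Eventually.of_forall hR0) hRi c
      have : ν.real {x | c ≤ R x} ≤ (∫ x, f x ∂ν) / c := by
        rw [le_div_iff₀ hc]; linarith
      calc ν {x | 0 < mx T g (N + 1) x} ≤ ν {x | c ≤ R x} := measure_mono fun x hx => hpt x hx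
        _ = ENNReal.ofReal (ν.real {x | c ≤ R x}) := by simp
        _ ≤ _ := ENNReal.ofReal_le_ofReal this
  have hsub : {x | ∃ N : ℕ, c * N < ∑ n ∈ Finset.range N, f (T^[n] x)} ⊆
      ⋃ N, {x | 0 < mx T g N x} := by
    rintro x ⟨N, hN⟩
    refine mem_iUnion.2 ⟨N, ?_⟩
    have h := sum_le_mx T g N x
    simp only [hgdef, Finset.sum_sub_distrib, Finset.sum_const, Finset.card_range,
      nsmul_eq_mul] at h
    show 0 < mx T g N x
    simp only [hgdef]
    linarith
  have hmono : Monotone fun N => {x | 0 < mx T g N x} :=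
    monotone_nat_of_le_succ fun N x hx => lt_of_lt_of_le hx (mx_mono T g N x)
  refine (measure_mono hsub).trans ?_
  rw [hmono.measure_iUnion]
  exact iSup_le key

/-- a.e. boundedness of averages. -/
lemma ae_bdd {ν : Measure X} [IsProbabilityMeasure ν] {T : X → X}
    (hT : MeasurePreserving T ν ν) {f : X → ℝ} (hf : Integrable f ν) (hf0 : ∀ x, 0 ≤ f x) :
    ∀ᵐ x ∂ν, ∃ C : ℝ, ∀ N : ℕ, ∑ n ∈ Finset.range N, f (T^[n] x) ≤ C * N := by
  rw [ae_iff]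
  refine le_antisymm ?_ zero_le
  have h1 : Tendsto (fun m : ℕ => ENNReal.ofReal ((∫ x, f x ∂ν) / ((m : ℝ) + 1))) atTop (nhds 0) := by
    rw [← ENNReal.ofReal_zero]
    refine ENNReal.tendsto_ofReal ?_
    have := tendsto_one_div_add_atTop_nhds_zero_nat (𝕜 := ℝ)
    simpa [div_eq_mul_inv] using this.const_mul (∫ x, f x ∂ν)
  refine ge_of_tendsto' h1 fun m => ?_
  refine le_trans (measure_mono ?_) (max_ineq hT hf hf0 (c := (m:ℝ) + 1) (by positivity))
  intro x hx
  simp only [mem_ofPred_eq, not_exists, not_forall, not_le] at hx ⊢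
  exact hx _

/-- convergence of all twisted averages, frequency in [-R,R]. -/
def Conv (R : ℝ) (a : ℕ → ℂ) : Prop :=
  ∀ t ∈ Icc (-R) R, ∃ L : ℂ, Tendsto (fun N : ℕ => (N : ℂ)⁻¹ *
    ∑ n ∈ Finset.range N, Complex.exp (t * n * Complex.I) * a n) atTop (nhds L)

def Good (ν : Measure X) (T : X → X) (R : ℝ) (f : X → ℂ) : Prop :=
  ∀ᵐ x ∂ν, Conv R (fun n => f (T^[n] x))

lemma norm_e (t : ℝ) (n : ℕ) : ‖Complex.exp (t * n * Complex.I)‖ = 1 := by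
  have := Complex.norm_exp_ofReal_mul_I (t * n)
  push_cast at this
  exact this

lemma ae_iterate {ν : Measure X} {T : X → X} (hT : MeasurePreserving T ν ν) {p : X → Prop}
    (h : ∀ᵐ x ∂ν, p x) : ∀ᵐ x ∂ν, ∀ n, p (T^[n] x) :=
  ae_all_iff.2 fun n => (hT.iterate n).quasiMeasurePreserving.ae h

lemma Good.congr {ν : Measure X} {T : X → X} (hT : MeasurePreserving T ν ν) {R : ℝ} {f g : X → ℂ}
    (h : f =ᵐ[ν] g) (hf : Good ν T R f) : Good ν T R g := by
  filter_upwards [hf, ae_iterate hT h] with x hx hy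
  have : (fun n => g (T^[n] x)) = fun n => f (T^[n] x) := funext fun n => (hy n).symm
  rw [this]; exact hx

lemma Good.add {ν : Measure X} {T : X → X} {R : ℝ} {f g : X → ℂ}
    (hf : Good ν T R f) (hg : Good ν T R g) : Good ν T R (f + g) := by
  filter_upwards [hf, hg] with x hx hy t ht
  obtain ⟨L, hL⟩ := hx t ht
  obtain ⟨L', hL'⟩ := hy t ht
  refine ⟨L + L', (hL.add hL').congr fun N => ?_⟩
  rw [← mul_add, ← Finset.sum_add_distrib]
  simp [mul_add]

lemma Good.smul {ν : Measure X} {T : X → X} {R : ℝ} {f : X → ℂ} (c : ℂ)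
    (hf : Good ν T R f) : Good ν T R (c • f) := by
  filter_upwards [hf] with x hx t ht
  obtain ⟨L, hL⟩ := hx t ht
  refine ⟨c * L, (hL.const_mul c).congr fun N => ?_⟩
  simp only [Finset.mul_sum, Pi.smul_apply, smul_eq_mul]
  exact Finset.sum_congr rfl fun n _ => by ring

/-- closedness under `L¹` approximation. -/
lemma Good.closed {ν : Measure X} [IsProbabilityMeasure ν] {T : X → X}
    (hT : MeasurePreserving T ν ν) {R : ℝ} {f : X → ℂ} (hf : Integrable f ν)
    (h : ∀ ε > 0, ∃ g, Integrable g ν ∧ Good ν T R g ∧ ∫ x, ‖f x - g x‖ ∂ν ≤ ε) :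
    Good ν T R f := by
  choose! g hgi hgg hge using h
  have hpos : ∀ j : ℕ, (0 : ℝ) < 1 / ((j : ℝ) + 1) := fun j => by positivity
  have hG : ∀ᵐ x ∂ν, ∀ j : ℕ, Conv R (fun n => g (1 / ((j : ℝ) + 1)) (T^[n] x)) :=
    ae_all_iff.2 fun j => hgg _ (hpos j)
  have hM : ∀ᵐ x ∂ν, ∀ m : ℕ, ∃ j : ℕ, ∀ N : ℕ, ∑ n ∈ Finset.range N,
      ‖f (T^[n] x) - g (1 / ((j : ℝ) + 1)) (T^[n] x)‖ ≤ 1 / ((m : ℝ) + 1) * N := by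
    refine ae_all_iff.2 fun m => ?_
    rw [ae_iff]
    refine le_antisymm ?_ zero_le
    have h1 : Tendsto (fun j : ℕ => ENNReal.ofReal ((1 / ((j : ℝ) + 1)) / (1 / ((m : ℝ) + 1))))
        atTop (nhds 0) := by
      rw [← ENNReal.ofReal_zero]
      refine ENNReal.tendsto_ofReal ?_
      have := tendsto_one_div_add_atTop_nhds_zero_nat (𝕜 := ℝ)
      simpa using this.div_const (1 / ((m : ℝ) + 1))
    refine ge_of_tendsto' h1 fun j => ?_
    have h2 := max_ineq hT (f := fun x => ‖f x - g (1 / ((j : ℝ) + 1)) x‖)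
      (hf.sub (hgi _ (hpos j))).norm (fun x => norm_nonneg _) (hpos m)
    refine le_trans (measure_mono ?_) (h2.trans ?_)
    · intro x hx
      simp only [mem_ofPred_eq, not_exists, not_forall, not_le] at hx ⊢
      exact hx j
    · exact ENNReal.ofReal_le_ofReal (div_le_div_of_nonneg_right (hge _ (hpos j)) (hpos m).le)
  filter_upwards [hG, hM] with x hx hy t ht
  refine cauchySeq_tendsto_of_complete ?_
  refine Metric.cauchySeq_iff'.2 fun ε hε => ?_
  obtain ⟨m, hm⟩ := exists_nat_one_div_lt (show 0 < ε / 3 by positivity)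
  obtain ⟨j, hj⟩ := hy m
  obtain ⟨L, hL⟩ := hx j t ht
  obtain ⟨N0, hN0⟩ := Metric.cauchySeq_iff'.1 hL.cauchySeq (ε / 3) (by positivity)
  have hd : ∀ N : ℕ, dist ((N : ℂ)⁻¹ * ∑ n ∈ Finset.range N,
        Complex.exp (t * n * Complex.I) * f (T^[n] x))
      ((N : ℂ)⁻¹ * ∑ n ∈ Finset.range N,
        Complex.exp (t * n * Complex.I) * g (1 / ((j : ℝ) + 1)) (T^[n] x)) < ε / 3 := by
    intro N
    refine lt_of_le_of_lt ?_ hm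
    rw [dist_eq_norm, ← mul_sub, ← Finset.sum_sub_distrib, norm_mul, norm_inv, Complex.norm_natCast]
    have : ‖∑ n ∈ Finset.range N, (Complex.exp (t * n * Complex.I) * f (T^[n] x) -
        Complex.exp (t * n * Complex.I) * g (1 / ((j : ℝ) + 1)) (T^[n] x))‖ ≤
        1 / ((m : ℝ) + 1) * N := by
      refine (norm_sum_le _ _).trans (le_trans (le_of_eq ?_) (hj N))
      refine Finset.sum_congr rfl fun n _ => ?_
      rw [← mul_sub, norm_mul, norm_e, one_mul]
    rcases Nat.eq_zero_or_pos N with rfl | hN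
    · simp; positivity
    · have hN' : (0 : ℝ) < N := by exact_mod_cast hN
      rw [inv_mul_le_iff₀ hN']; linarith
  refine ⟨N0, fun n hn => ?_⟩
  have a1 := hd n
  have a2 := hd N0
  have a3 := hN0 n hn
  rw [dist_comm] at a2
  calc _ ≤ _ := dist_triangle4 _ _ _ _
    _ < ε / 3 + ε / 3 + ε / 3 := by gcongr
    _ = ε := by ring
end WW


namespace WW

/-- local averages -/
noncomputable def W (H : ℕ) (a : ℕ → ℂ) (t : ℝ) (n : ℕ) : ℝ :=
  ‖(H : ℂ)⁻¹ * ∑ h ∈ Finset.range H, Complex.exp (t * h * Complex.I) * a (n + h)‖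

noncomputable def F (H : ℕ) (a : ℕ → ℂ) (t : ℝ) : ℝ :=
  limsup (fun N : ℕ => (∑ n ∈ Finset.range N, W H a t n) / N) atTop

def Nice (a : ℕ → ℂ) : Prop :=
  (∃ C : ℝ, ∀ N : ℕ, ∑ n ∈ Finset.range N, ‖a n‖ ≤ C * N) ∧
  Tendsto (fun n : ℕ => ‖a n‖ / n) atTop (nhds 0)

lemma W_nonneg (H a t n) : 0 ≤ W H a t n := norm_nonneg _

lemma inv_nat_le_one (H : ℕ) : (H : ℝ)⁻¹ ≤ 1 := by
  rcases Nat.eq_zero_or_pos H with rfl | h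
  · simp
  · exact inv_le_one_of_one_le₀ (by exact_mod_cast h)

lemma W_le (H a t n) : W H a t n ≤ ∑ h ∈ Finset.range H, ‖a (n + h)‖ := by
  unfold W
  rw [norm_mul, norm_inv, Complex.norm_natCast]
  refine (mul_le_of_le_one_left (norm_nonneg _) (inv_nat_le_one H)).trans ?_
  refine (norm_sum_le _ _).trans (le_of_eq ?_)
  exact Finset.sum_congr rfl fun h _ => by rw [norm_mul, norm_e, one_mul]

lemma exp_lip (t s : ℝ) (h : ℕ) :
    ‖Complex.exp (t * h * Complex.I) - Complex.exp (s * h * Complex.I)‖ ≤ h * |t - s| := by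
  have e : Complex.exp (t * h * Complex.I) - Complex.exp (s * h * Complex.I) =
      Complex.exp (s * h * Complex.I) * (Complex.exp (Complex.I * (((t - s) * h : ℝ) : ℂ)) - 1) := by
    rw [mul_sub, ← Complex.exp_add]; push_cast; ring_nf
  rw [e, norm_mul, norm_e, one_mul]
  refine (Real.norm_exp_I_mul_ofReal_sub_one_le).trans ?_
  rw [Real.norm_eq_abs, abs_mul, Nat.abs_cast, mul_comm]

lemma W_lip (H a n) (t s : ℝ) :
    W H a t n ≤ W H a s n + H * |t - s| * ∑ h ∈ Finset.range H, ‖a (n + h)‖ := by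
  unfold W
  have := norm_sub_norm_le ((H : ℂ)⁻¹ * ∑ h ∈ Finset.range H, Complex.exp (t * h * Complex.I) * a (n + h))
    ((H : ℂ)⁻¹ * ∑ h ∈ Finset.range H, Complex.exp (s * h * Complex.I) * a (n + h))
  rw [← mul_sub, ← Finset.sum_sub_distrib] at this
  simp only [norm_mul, norm_inv, Complex.norm_natCast] at this ⊢
  have h2 : (H : ℝ)⁻¹ * ‖∑ h ∈ Finset.range H, (Complex.exp (t * h * Complex.I) * a (n + h) -
      Complex.exp (s * h * Complex.I) * a (n + h))‖ ≤ H * |t - s| * ∑ h ∈ Finset.range H, ‖a (n + h)‖ := by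
    refine (mul_le_of_le_one_left (norm_nonneg _) (inv_nat_le_one H)).trans ?_
    refine (norm_sum_le _ _).trans ?_
    rw [Finset.mul_sum]
    refine Finset.sum_le_sum fun h hh => ?_
    rw [← sub_mul, norm_mul]
    refine mul_le_mul_of_nonneg_right ((exp_lip t s h).trans ?_) (norm_nonneg _)
    have : (h : ℝ) ≤ H := by exact_mod_cast (Finset.mem_range.1 hh).le
    gcongr
  linarith

lemma sum_shift_le {a : ℕ → ℂ} {C : ℝ} (hC : ∀ N : ℕ, ∑ n ∈ Finset.range N, ‖a n‖ ≤ C * N) (H N : ℕ) :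
    (∑ n ∈ Finset.range N, ∑ h ∈ Finset.range H, ‖a (n + h)‖) / N ≤ H * (|C| * (1 + H)) := by
  rcases Nat.eq_zero_or_pos N with rfl | hN
  · simp; positivity
  have hN' : (1 : ℝ) ≤ N := by exact_mod_cast hN
  rw [div_le_iff₀ (by linarith), Finset.sum_comm]
  have : ∀ h ∈ Finset.range H, ∑ n ∈ Finset.range N, ‖a (n + h)‖ ≤ (|C| * (1 + H)) * N := by
    intro h hh
    have hh' : (h : ℝ) ≤ H := by exact_mod_cast (Finset.mem_range.1 hh).le
    have h1 : ∑ n ∈ Finset.range N, ‖a (n + h)‖ ≤ ∑ n ∈ Finset.range (h + N), ‖a n‖ := by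
      rw [Finset.sum_range_add]
      have : 0 ≤ ∑ n ∈ Finset.range h, ‖a n‖ := Finset.sum_nonneg fun _ _ => norm_nonneg _
      simp only [add_comm h]
      linarith
    refine h1.trans ((hC _).trans ?_)
    push_cast
    have h3 : C * (h + N) ≤ |C| * (h + N) := by gcongr; exact le_abs_self C
    refine h3.trans ?_
    rw [mul_assoc]
    refine mul_le_mul_of_nonneg_left ?_ (abs_nonneg C)
    nlinarith [(Nat.cast_nonneg H : (0:ℝ) ≤ H)]
  refine (Finset.sum_le_sum this).trans (le_of_eq ?_)
  rw [Finset.sum_const, Finset.card_range, nsmul_eq_mul]; ring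

lemma avg_nonneg (H a t) (N : ℕ) : 0 ≤ (∑ n ∈ Finset.range N, W H a t n) / N :=
  div_nonneg (Finset.sum_nonneg fun _ _ => W_nonneg _ _ _ _) (Nat.cast_nonneg _)

lemma avg_bdd {a : ℕ → ℂ} (ha : Nice a) (H : ℕ) (t : ℝ) :
    IsBoundedUnder (· ≤ ·) atTop (fun N : ℕ => (∑ n ∈ Finset.range N, W H a t n) / N) := by
  obtain ⟨C, hC⟩ := ha.1
  refine isBoundedUnder_of ⟨H * (|C| * (1 + H)), fun N => ?_⟩
  refine le_trans ?_ (sum_shift_le hC H N)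
  gcongr
  exact W_le _ _ _ _

lemma avg_cobdd (H a t) :
    IsCoboundedUnder (· ≤ ·) atTop (fun N : ℕ => (∑ n ∈ Finset.range N, W H a t n) / N) :=
  IsBoundedUnder.isCoboundedUnder_le (isBoundedUnder_of ⟨0, fun N => avg_nonneg H a t N⟩)

lemma limsup_cmp {u v : ℕ → ℝ} {ε : ℝ} (hu : IsCoboundedUnder (· ≤ ·) atTop u)
    (hv : IsBoundedUnder (· ≤ ·) atTop v) (hv' : IsCoboundedUnder (· ≤ ·) atTop v)
    (h : ∀ᶠ N in atTop, u N ≤ v N + ε) : limsup u atTop ≤ limsup v atTop + ε := by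
  rw [← limsup_add_const atTop v ε hv hv']
  refine limsup_le_limsup h hu ?_
  obtain ⟨b, hb⟩ := hv
  refine ⟨b + ε, ?_⟩
  simp only [eventually_map] at hb ⊢
  filter_upwards [hb] with n hn using by linarith

lemma F_lip {a : ℕ → ℂ} (ha : Nice a) (H : ℕ) : ∃ K : ℝ, ∀ t s, F H a t ≤ F H a s + K * |t - s| := by
  obtain ⟨C, hC⟩ := ha.1
  refine ⟨H * (H * (|C| * (1 + H))), fun t s => ?_⟩
  refine limsup_cmp (avg_cobdd _ _ _) (avg_bdd ha _ _) (avg_cobdd _ _ _) (Eventually.of_forall fun N => ?_)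
  have h1 : ∑ n ∈ Finset.range N, W H a t n ≤ ∑ n ∈ Finset.range N, W H a s n +
      H * |t - s| * ∑ n ∈ Finset.range N, ∑ h ∈ Finset.range H, ‖a (n + h)‖ := by
    rw [Finset.mul_sum, ← Finset.sum_add_distrib]
    exact Finset.sum_le_sum fun n _ => W_lip H a n t s
  have h2 := sum_shift_le hC H N
  calc _ ≤ (∑ n ∈ Finset.range N, W H a s n +
      H * |t - s| * ∑ n ∈ Finset.range N, ∑ h ∈ Finset.range H, ‖a (n + h)‖) / N := by gcongr
    _ = (∑ n ∈ Finset.range N, W H a s n) / N + H * |t - s| *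
      ((∑ n ∈ Finset.range N, ∑ h ∈ Finset.range H, ‖a (n + h)‖) / N) := by ring
    _ ≤ (∑ n ∈ Finset.range N, W H a s n) / N + H * |t - s| * (H * (|C| * (1 + H))) := by gcongr
    _ = _ := by ring

lemma F_cont {a : ℕ → ℂ} (ha : Nice a) (H : ℕ) : Continuous (F H a) := by
  obtain ⟨K, hK⟩ := F_lip ha H
  refine (LipschitzWith.of_le_add_mul (K := K.toNNReal) fun t s => ?_).continuous
  refine (hK t s).trans ?_
  rw [Real.dist_eq]
  gcongr
  exact Real.le_coe_toNNReal K

lemma shift_tendsto {c : ℕ → ℂ} (hc : Tendsto (fun n : ℕ => ‖c n‖ / n) atTop (nhds 0)) (h : ℕ) :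
    Tendsto (fun n : ℕ => ‖c (n + h)‖ / n) atTop (nhds 0) := by
  have h1 : Tendsto (fun n : ℕ => ‖c (n + h)‖ / ((n + h : ℕ) : ℝ)) atTop (nhds 0) :=
    hc.comp (tendsto_add_atTop_nat h)
  have h2 : Tendsto (fun n : ℕ => (1 + h : ℝ) * (‖c (n + h)‖ / ((n + h : ℕ) : ℝ))) atTop (nhds 0) := by
    simpa using h1.const_mul (1 + h : ℝ)
  refine squeeze_zero' (Eventually.of_forall fun n => by positivity) ?_ h2
  filter_upwards [eventually_ge_atTop 1] with n hn
  have hn' : (1 : ℝ) ≤ n := by exact_mod_cast hn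
  rw [div_le_iff₀ (by linarith)]
  have hh : (0 : ℝ) ≤ h := Nat.cast_nonneg h
  have : (1 : ℝ) ≤ (1 + h : ℝ) * n / ((n + h : ℕ) : ℝ) := by
    rw [one_le_div (by push_cast; linarith)]; push_cast; nlinarith
  calc ‖c (n + h)‖ = ‖c (n + h)‖ * 1 := by ring
    _ ≤ ‖c (n + h)‖ * ((1 + h : ℝ) * n / ((n + h : ℕ) : ℝ)) := by gcongr
    _ = _ := by ring

lemma W_div {a : ℕ → ℂ} (ha : Nice a) (H : ℕ) (t : ℝ) :
    Tendsto (fun n : ℕ => W H a t n / n) atTop (nhds 0) := by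
  have : Tendsto (fun n : ℕ => ∑ h ∈ Finset.range H, ‖a (n + h)‖ / n) atTop (nhds 0) := by
    simpa using tendsto_finsetSum (Finset.range H) fun h _ => shift_tendsto ha.2 h
  refine squeeze_zero (fun n => div_nonneg (W_nonneg _ _ _ _) (Nat.cast_nonneg _)) (fun n => ?_) this
  rw [← Finset.sum_div]
  gcongr
  exact W_le _ _ _ _

lemma F_shift {a : ℕ → ℂ} (ha : Nice a) (ha' : Nice fun n => a (n + 1)) (H : ℕ) (t : ℝ) :
    F H (fun n => a (n + 1)) t = F H a t := by
  have hW : ∀ n, W H (fun n => a (n + 1)) t n = W H a t (n + 1) := by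
    intro n; unfold W; simp only [add_right_comm]
  have hd : Tendsto (fun N : ℕ => (∑ n ∈ Finset.range N, W H (fun n => a (n + 1)) t n) / N
      - (∑ n ∈ Finset.range N, W H a t n) / N) atTop (nhds 0) := by
    have h1 : Tendsto (fun N : ℕ => W H a t N / N - W H a t 0 / N) atTop (nhds 0) := by
      simpa using (W_div ha H t).sub (tendsto_const_div_atTop_nhds_zero_nat (W H a t 0))
    refine h1.congr fun N => ?_
    simp only [hW]
    rw [← sub_div, ← sub_div, ← Finset.sum_range_succ_sub_sum (W H a t) (n := N), 
      Finset.sum_range_succ' (W H a t)]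
    ring
  refine le_antisymm ?_ ?_
  · refine le_of_forall_pos_le_add fun ε hε => ?_
    refine limsup_cmp (avg_cobdd _ _ _) (avg_bdd ha _ _) (avg_cobdd _ _ _) ?_
    filter_upwards [hd.eventually (gt_mem_nhds hε)] with N hN using by linarith
  · refine le_of_forall_pos_le_add fun ε hε => ?_
    refine limsup_cmp (avg_cobdd _ _ _) (avg_bdd ha' _ _) (avg_cobdd _ _ _) ?_
    filter_upwards [hd.eventually (lt_mem_nhds (show -ε < 0 by linarith))] with N hN using by linarith

/-- The local averages control the global ones. -/
lemma ctrl {a : ℕ → ℂ} (ha : Nice a) {H : ℕ} (hH : 0 < H) {t ε : ℝ} (hε : 0 < ε) (hF : F H a t < ε) :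
    ∀ᶠ N : ℕ in atTop, ‖(N : ℂ)⁻¹ * ∑ n ∈ Finset.range N, Complex.exp (t * n * Complex.I) * a n‖
      < 2 * ε := by
  set b : ℕ → ℂ := fun n => Complex.exp (t * n * Complex.I) * a n with hb
  have hbn : ∀ n, ‖b n‖ = ‖a n‖ := fun n => by rw [hb]; simp only [norm_mul, norm_e, one_mul]
  have hbt : Tendsto (fun n : ℕ => ‖b n‖ / n) atTop (nhds 0) := by simpa only [hbn] using ha.2
  have hshift : ∀ h : ℕ, Tendsto (fun N : ℕ => (N : ℂ)⁻¹ * (∑ n ∈ Finset.range N, b n -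
      ∑ n ∈ Finset.range N, b (n + h))) atTop (nhds 0) := by
    intro h
    induction h with
    | zero => simp
    | succ h ih =>
      have h1 : Tendsto (fun N : ℕ => (N : ℂ)⁻¹ * (b h - b (N + h))) atTop (nhds 0) := by
        rw [tendsto_zero_iff_norm_tendsto_zero]
        have h2 : Tendsto (fun N : ℕ => ‖b h‖ / N + ‖b (N + h)‖ / N) atTop (nhds 0) := by
          simpa using (tendsto_const_div_atTop_nhds_zero_nat ‖b h‖).add (shift_tendsto hbt h)
        refine squeeze_zero (fun _ => norm_nonneg _) (fun N => ?_) h2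
        rw [norm_mul, norm_inv, Complex.norm_natCast, ← add_div, div_eq_inv_mul]
        gcongr
        exact norm_sub_le _ _
      have h3 := ih.add h1
      rw [add_zero] at h3
      refine h3.congr fun N => ?_
      have e1 := Finset.sum_range_succ (fun n => b (n + h)) N
      have e2 := Finset.sum_range_succ' (fun n => b (n + h)) N
      simp only [zero_add, add_right_comm _ 1 h] at e2
      rw [← mul_add]
      congr 1
      have e3 : ∑ n ∈ Finset.range N, b (n + (h + 1)) = ∑ n ∈ Finset.range N, b (n + h + 1) := rfl
      rw [e3]
      linear_combination e1 - e2
  have hD : Tendsto (fun N : ℕ => (N : ℂ)⁻¹ * (∑ n ∈ Finset.range N, b n -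
      ∑ n ∈ Finset.range N, (H : ℂ)⁻¹ * ∑ h ∈ Finset.range H, b (n + h))) atTop (nhds 0) := by
    have h1 := (tendsto_finsetSum (Finset.range H) fun h _ => hshift h).const_mul (H : ℂ)⁻¹
    simp only [Finset.sum_const_zero, mul_zero] at h1
    refine h1.congr fun N => ?_
    rw [← Finset.mul_sum, Finset.sum_sub_distrib, Finset.sum_const, Finset.card_range, nsmul_eq_mul,
      ← Finset.mul_sum, Finset.sum_comm (s := Finset.range N)]
    have : (H : ℂ) ≠ 0 := by exact_mod_cast hH.ne'
    field_simp
  have hWb : ∀ n, ‖(H : ℂ)⁻¹ * ∑ h ∈ Finset.range H, b (n + h)‖ = W H a t n := by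
    intro n
    have : (H : ℂ)⁻¹ * ∑ h ∈ Finset.range H, b (n + h) = Complex.exp (t * n * Complex.I) *
        ((H : ℂ)⁻¹ * ∑ h ∈ Finset.range H, Complex.exp (t * h * Complex.I) * a (n + h)) := by
      rw [mul_left_comm, Finset.mul_sum (a := Complex.exp _)]
      congr 1
      refine Finset.sum_congr rfl fun h _ => ?_
      rw [← mul_assoc, ← Complex.exp_add]
      show Complex.exp (t * ((n + h : ℕ) : ℂ) * Complex.I) * a (n + h) = _
      congr 2
      push_cast; ring
    rw [this, norm_mul, norm_e, one_mul, W]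
  have h1 : ∀ᶠ N : ℕ in atTop, (∑ n ∈ Finset.range N, W H a t n) / N < ε :=
    eventually_lt_of_limsup_lt hF (avg_bdd ha H t)
  have h2 := (tendsto_zero_iff_norm_tendsto_zero.1 hD).eventually (gt_mem_nhds hε)
  filter_upwards [h1, h2] with N a1 a2
  have e : (N : ℂ)⁻¹ * ∑ n ∈ Finset.range N, b n = (N : ℂ)⁻¹ * (∑ n ∈ Finset.range N, b n -
      ∑ n ∈ Finset.range N, (H : ℂ)⁻¹ * ∑ h ∈ Finset.range H, b (n + h)) + 
      (N : ℂ)⁻¹ * ∑ n ∈ Finset.range N, (H : ℂ)⁻¹ * ∑ h ∈ Finset.range H, b (n + h) := by ring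
  have a3 : ‖(N : ℂ)⁻¹ * ∑ n ∈ Finset.range N, (H : ℂ)⁻¹ * ∑ h ∈ Finset.range H, b (n + h)‖ ≤
      (∑ n ∈ Finset.range N, W H a t n) / N := by
    rw [norm_mul, norm_inv, Complex.norm_natCast, div_eq_inv_mul]
    gcongr
    refine (norm_sum_le _ _).trans (le_of_eq ?_)
    exact Finset.sum_congr rfl fun n _ => hWb n
  rw [e]
  refine (norm_add_le _ _).trans_lt ?_
  linarith
end WW


namespace WW
variable {X : Type*} [MeasurableSpace X]

lemma meas_exists (Φ : ℕ → X → ℝ → ℝ) (hm : ∀ k t, Measurable fun x => Φ k x t)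
    (hc : ∀ k x, Continuous (Φ k x)) (a c : ℝ) :
    MeasurableSet {x | ∃ t ∈ Icc a c, ∀ k, 0 ≤ Φ k x t} := by
  obtain ⟨D, hDc, hD⟩ := TopologicalSpace.exists_countable_dense (Icc a c)
  have e : {x | ∃ t ∈ Icc a c, ∀ k, 0 ≤ Φ k x t} =
      ⋂ m : ℕ, ⋃ q ∈ D, ⋂ k ∈ Finset.range m, {x | -(1 / ((m : ℝ) + 1)) < Φ k x (q : ℝ)} := by
    ext x
    simp only [mem_ofPred_eq, mem_iInter, mem_iUnion, exists_prop, Finset.mem_range]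
    constructor
    · rintro ⟨t, ht, h⟩ m
      have hopen : IsOpen {s : Icc a c | ∀ k ∈ Finset.range m, -(1 / ((m : ℝ) + 1)) < Φ k x s} := by
        have : {s : Icc a c | ∀ k ∈ Finset.range m, -(1 / ((m : ℝ) + 1)) < Φ k x s} =
          ⋂ k ∈ Finset.range m, {s : Icc a c | -(1 / ((m : ℝ) + 1)) < Φ k x s} := by
          ext; simp
        rw [this]
        exact isOpen_biInter_finset fun k _ =>
          isOpen_lt continuous_const ((hc k x).comp continuous_subtype_val)
      obtain ⟨q, hq, hqD⟩ := hD.inter_open_nonempty _ hopen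
        ⟨⟨t, ht⟩, fun k _ => lt_of_lt_of_le (by simp; positivity) (h k)⟩
      exact ⟨q, hqD, fun k hk => hq k (Finset.mem_range.2 hk)⟩
    · intro h
      choose q hqD hq using h
      obtain ⟨t, -, φ, hφ, hlim⟩ := isCompact_univ.tendsto_subseq (x := q) fun n => mem_univ _
      refine ⟨t, t.2, fun k => ?_⟩
      have h1 : Tendsto (fun n => Φ k x (q (φ n))) atTop (nhds (Φ k x t)) :=
        (((hc k x).comp continuous_subtype_val).tendsto t).comp hlim
      have h2 : Tendsto (fun n => -(1 / ((φ n : ℝ) + 1))) atTop (nhds 0) := by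
        simpa using ((tendsto_one_div_add_atTop_nhds_zero_nat (𝕜 := ℝ)).comp hφ.tendsto_atTop).neg
      refine le_of_tendsto_of_tendsto h2 h1 ?_
      filter_upwards [eventually_gt_atTop k] with n hn
      exact (hq (φ n) k (hn.trans_le (hφ.id_le n))).le
  rw [e]
  refine MeasurableSet.iInter fun m => MeasurableSet.biUnion hDc fun q _ =>
    Finset.measurableSet_biInter _ fun k _ => ?_
  exact measurableSet_lt measurable_const (hm k q)

lemma selection (Φ : ℕ → X → ℝ → ℝ) (hm : ∀ k t, Measurable fun x => Φ k x t)
    (hc : ∀ k x, Continuous (Φ k x)) (a b : ℝ) :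
    ∃ θ : X → ℝ, Measurable θ ∧ (∀ x, (∃ t ∈ Icc a b, ∀ k, 0 ≤ Φ k x t) → ∀ k, 0 ≤ Φ k x (θ x)) ∧
      ∀ x y, (∀ k t, Φ k x t = Φ k y t) → θ x = θ y := by
  set Z : X → Set ℝ := fun x => {t | t ∈ Icc a b ∧ ∀ k, 0 ≤ Φ k x t} with hZ
  have hZc : ∀ x, IsClosed (Z x) := by
    intro x
    have : Z x = Icc a b ∩ ⋂ k, {t | 0 ≤ Φ k x t} := by ext; simp [hZ]
    rw [this]
    exact isClosed_Icc.inter (isClosed_iInter fun k => isClosed_le continuous_const (hc k x))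
  have hZb : ∀ x, BddBelow (Z x) := fun x => ⟨a, fun t ht => ht.1.1⟩
  have hmem : ∀ x, (Z x).Nonempty → sInf (Z x) ∈ Z x := fun x h => (hZc x).csInf_mem h (hZb x)
  refine ⟨fun x => sInf (Z x), ?_, ?_, ?_⟩
  · refine measurable_of_Iic fun c => ?_
    have e : (fun x => sInf (Z x)) ⁻¹' Iic c =
        {x | ∃ t ∈ Icc a (min b c), ∀ k, 0 ≤ Φ k x t} ∪
          ({x | ∃ t ∈ Icc a b, ∀ k, 0 ≤ Φ k x t}ᶜ ∩ {_x | 0 ≤ c}) := by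
      ext x
      simp only [mem_preimage, mem_Iic, mem_union, mem_inter_iff, mem_compl_iff, mem_ofPred_eq]
      constructor
      · intro h
        by_cases hne : (Z x).Nonempty
        · left
          have := hmem x hne
          exact ⟨_, ⟨this.1.1, le_min this.1.2 h⟩, this.2⟩
        · right
          have h0 : Z x = ∅ := not_nonempty_iff_eq_empty.1 hne
          rw [h0, Real.sInf_empty] at h
          exact ⟨fun ⟨t, ht, hk⟩ => hne ⟨t, ht, hk⟩, h⟩
      · rintro (⟨t, ht, hk⟩ | ⟨h1, h2⟩)
        · have htZ : t ∈ Z x := ⟨⟨ht.1, ht.2.trans (min_le_left _ _)⟩, hk⟩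
          exact (csInf_le (hZb x) htZ).trans (ht.2.trans (min_le_right _ _))
        · have h0 : Z x = ∅ := by
            rw [← not_nonempty_iff_eq_empty]
            rintro ⟨t, ht, hk⟩
            exact h1 ⟨t, ht, hk⟩
          rw [h0, Real.sInf_empty]; exact h2
    rw [e]
    exact (meas_exists Φ hm hc _ _).union ((meas_exists Φ hm hc _ _).compl.inter (MeasurableSet.const _))
  · rintro x ⟨t, ht, hk⟩
    exact (hmem x ⟨t, ht, hk⟩).2
  · intro x y h
    have : Z x = Z y := by ext t; simp [hZ, h]
    simp only [this]

/-! ### The twisted Koopman operator -/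

lemma memLp_twist {ν : Measure X} {T : X → X} (hT : MeasurePreserving T ν ν) {θ : X → ℝ}
    (hθ : Measurable θ) {g : X → ℂ} (hg : MemLp g 2 ν) :
    MemLp (fun x => Complex.exp (θ x * Complex.I) * g (T x)) 2 ν := by
  have h1 : MemLp (fun x => g (T x)) 2 ν := hg.comp_measurePreserving hT
  refine MemLp.of_le h1 ?_ (Eventually.of_forall fun x => ?_)
  · refine AEStronglyMeasurable.mul ?_ h1.1
    exact (by fun_prop : Measurable fun x => Complex.exp (θ x * Complex.I)).aestronglyMeasurable
  · rw [norm_mul, Complex.norm_exp_ofReal_mul_I, one_mul]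

lemma exists_twist {ν : Measure X} {T : X → X} (hT : MeasurePreserving T ν ν) {θ : X → ℝ}
    (hθ : Measurable θ) :
    ∃ U : Lp ℂ 2 ν →L[ℂ] Lp ℂ 2 ν, ‖U‖ ≤ 1 ∧
      ∀ g : Lp ℂ 2 ν, U g =ᵐ[ν] fun x => Complex.exp (θ x * Complex.I) * g (T x) := by
  let V : Lp ℂ 2 ν →ₗ[ℂ] Lp ℂ 2 ν :=
    { toFun := fun g => (memLp_twist hT hθ (Lp.memLp g)).toLp _
      map_add' := fun f g => by
        rw [← MemLp.toLp_add]
        refine MemLp.toLp_congr _ _ ?_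
        filter_upwards [hT.quasiMeasurePreserving.ae (Lp.coeFn_add f g)] with x hx
        simp only [hx, Pi.add_apply, mul_add]
      map_smul' := fun c g => by
        rw [RingHom.id_apply, ← MemLp.toLp_const_smul]
        refine MemLp.toLp_congr _ _ ?_
        filter_upwards [hT.quasiMeasurePreserving.ae (Lp.coeFn_smul c g)] with x hx
        simp only [hx, Pi.smul_apply, smul_eq_mul]
        ring }
  have hV : ∀ g, ‖V g‖ ≤ 1 * ‖g‖ := by
    intro g
    rw [one_mul]
    show ‖(memLp_twist hT hθ (Lp.memLp g)).toLp _‖ ≤ _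
    rw [Lp.norm_toLp, Lp.norm_def]
    refine ENNReal.toReal_mono (Lp.eLpNorm_ne_top g) ?_
    rw [← eLpNorm_comp_measurePreserving (Lp.aestronglyMeasurable g) hT]
    refine eLpNorm_mono fun x => ?_
    rw [norm_mul, Complex.norm_exp_ofReal_mul_I, one_mul]; rfl
  refine ⟨V.mkContinuous 1 hV, LinearMap.mkContinuous_norm_le _ zero_le_one _, fun g => ?_⟩
  exact MemLp.coeFn_toLp (memLp_twist hT hθ (Lp.memLp g))

lemma twist_iter {ν : Measure X} {T : X → X} (hT : MeasurePreserving T ν ν) {θ : X → ℝ}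
    (hinv : ∀ᵐ x ∂ν, θ (T x) = θ x) {U : Lp ℂ 2 ν →L[ℂ] Lp ℂ 2 ν}
    (hU : ∀ g : Lp ℂ 2 ν, U g =ᵐ[ν] fun x => Complex.exp (θ x * Complex.I) * g (T x))
    (f : Lp ℂ 2 ν) (n : ℕ) :
    (U^[n] f : Lp ℂ 2 ν) =ᵐ[ν] fun x => Complex.exp (θ x * n * Complex.I) * f (T^[n] x) := by
  induction n with
  | zero => simp
  | succ n ih =>
    rw [Function.iterate_succ_apply']
    filter_upwards [hU (U^[n] f), hT.quasiMeasurePreserving.ae ih, hinv] with x h1 h2 h3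
    rw [h1, h2, h3, ← mul_assoc, ← Complex.exp_add, Function.iterate_succ_apply]
    congr 2
    push_cast; ring

/-- Generalized eigenfunctions are good. -/
lemma eigen_good {ν : Measure X} {T : X → X} (hT : MeasurePreserving T ν ν) {θ : X → ℝ}
    (hinv : ∀ᵐ x ∂ν, θ (T x) = θ x) {g : X → ℂ} (R : ℝ)
    (hg : ∀ᵐ x ∂ν, Complex.exp (θ x * Complex.I) * g (T x) = g x) : Good ν T R g := by
  filter_upwards [ae_iterate hT hinv, ae_iterate hT hg] with x h1 h2 t _
  have hθn : ∀ n, θ (T^[n] x) = θ x := by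
    intro n
    induction n with
    | zero => rfl
    | succ n ih => rw [Function.iterate_succ_apply', h1 n, ih]
  have hgn : ∀ n : ℕ, g (T^[n] x) = Complex.exp (-(θ x * Complex.I)) ^ n * g x := by
    intro n
    induction n with
    | zero => simp
    | succ n ih =>
      have h3 := h2 n
      rw [hθn, ih, ← Function.iterate_succ_apply' T] at h3
      rw [pow_succ', mul_assoc, ← h3, ← mul_assoc, ← Complex.exp_add]
      simp
  set z : ℂ := Complex.exp (t * Complex.I) * Complex.exp (-(θ x * Complex.I)) with hz
  have hzn : ‖z‖ = 1 := by
    have := Complex.norm_exp_ofReal_mul_I (-(θ x))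
    push_cast at this
    rw [hz, norm_mul, Complex.norm_exp_ofReal_mul_I, ← neg_mul, this, one_mul]
  let A : ℂ →L[ℂ] ℂ := ContinuousLinearMap.mul ℂ ℂ z
  have hA : ‖A‖ ≤ 1 := (ContinuousLinearMap.opNorm_mul_apply_le ℂ ℂ z).trans hzn.le
  have hAn : ∀ n : ℕ, A^[n] (g x) = z ^ n * g x := by
    intro n
    induction n with
    | zero => simp
    | succ n ih => rw [Function.iterate_succ_apply', ih, pow_succ', mul_assoc]; rfl
  refine ⟨_, (A.tendsto_birkhoffAverage_orthogonalProjection hA (g x)).congr fun N => ?_⟩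
  rw [birkhoffAverage, birkhoffSum, smul_eq_mul]
  congr 1
  refine Finset.sum_congr rfl fun n _ => ?_
  simp only [hgn]
  rw [id, hAn, hz, mul_pow, ← Complex.exp_nat_mul (t * Complex.I), mul_assoc]
  congr 2
  ring
end WW


namespace WW
variable {X : Type*} [MeasurableSpace X]

lemma nice_ae {ν : Measure X} [IsProbabilityMeasure ν] {T : X → X}
    (hT : MeasurePreserving T ν ν) {f : X → ℂ} (hf : MemLp f 2 ν) :
    ∀ᵐ x ∂ν, Nice (fun n => f (T^[n] x)) := by
  have h2 : Integrable (fun x => ‖f x‖ ^ 2) ν := (memLp_two_iff_integrable_sq_norm hf.1).1 hf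
  filter_upwards [ae_bdd hT h2 (fun x => by positivity)] with x hx
  obtain ⟨C, hC⟩ := hx
  refine ⟨⟨C + 1, fun N => ?_⟩, ?_⟩
  · calc ∑ n ∈ Finset.range N, ‖f (T^[n] x)‖ ≤ ∑ n ∈ Finset.range N, (‖f (T^[n] x)‖ ^ 2 + 1) :=
          Finset.sum_le_sum fun n _ => by nlinarith [sq_nonneg (‖f (T^[n] x)‖ - 1), norm_nonneg (f (T^[n] x))]
      _ = ∑ n ∈ Finset.range N, ‖f (T^[n] x)‖ ^ 2 + N := by
          rw [Finset.sum_add_distrib]; simp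
      _ ≤ C * N + N := by gcongr; exact hC N
      _ = (C + 1) * N := by ring
  · have h1 : Tendsto (fun n : ℕ => Real.sqrt ((2 * C) / n)) atTop (nhds 0) := by
      have := (Real.continuous_sqrt.tendsto 0).comp (tendsto_const_div_atTop_nhds_zero_nat (2 * C))
      rw [Real.sqrt_zero] at this
      exact this
    refine squeeze_zero' (Eventually.of_forall fun n => by positivity) ?_ h1
    filter_upwards [eventually_ge_atTop 1] with n hn
    have hn' : (1 : ℝ) ≤ n := by exact_mod_cast hn
    refine Real.le_sqrt_of_sq_le ?_
    have h3 := hC (n + 1)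
    have hsq : ‖f (T^[n] x)‖ ^ 2 ≤ C * (n + 1 : ℕ) :=
      (Finset.single_le_sum (f := fun n => ‖f (T^[n] x)‖ ^ 2) (fun i _ => by positivity)
        (Finset.self_mem_range_succ n)).trans h3
    push_cast at hsq
    have hC0 : 0 ≤ C := by
      have : 0 ≤ C * ((n : ℝ) + 1) := le_trans (by positivity) hsq
      exact nonneg_of_mul_nonneg_left this (by linarith)
    rw [div_pow, div_le_div_iff₀ (by positivity) (by linarith)]
    have : ‖f (T^[n] x)‖ ^ 2 ≤ 2 * C * n := by nlinarith
    nlinarith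

lemma l1_le_l2 {ν : Measure X} [IsProbabilityMeasure ν] {h : X → ℂ} (hh : MemLp h 2 ν) :
    ∫ x, ‖h x‖ ∂ν ≤ (eLpNorm h 2 ν).toReal := by
  rw [integral_norm_eq_lintegral_enorm hh.1, ← eLpNorm_one_eq_lintegral_enorm]
  exact ENNReal.toReal_mono hh.2.ne (eLpNorm_le_eLpNorm_of_exponent_le (by norm_num) hh.1)

lemma perp_null {ν : Measure X} [IsProbabilityMeasure ν] {T : X → X}
    (hT : MeasurePreserving T ν ν) {R : ℝ} (f : Lp ℂ 2 ν)
    (hperp : ∀ g : Lp ℂ 2 ν, Good ν T R g → inner ℂ g f = 0)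
    {s : Set X} (hs : MeasurableSet s) (hs1 : ∀ᵐ x ∂ν, x ∈ s)
    (hnice : ∀ x ∈ s, Nice (fun n => f (T^[n] x))) {δ : ℝ} (hδ : 0 < δ) :
    ν {x | x ∈ s ∧ ∃ t ∈ Icc (-R) R, ∀ k : ℕ, δ ≤ F (k + 1) (fun n => f (T^[n] x)) t} = 0 := by
  classical
  have hfm : Measurable (f : X → ℂ) := (Lp.stronglyMeasurable f).measurable
  have hfT : ∀ n, Measurable fun x => f (T^[n] x) := fun n => hfm.comp (hT.measurable.iterate n)
  set Φ : ℕ → X → ℝ → ℝ := fun k x t =>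
    if x ∈ s then F (k + 1) (fun n => f (T^[n] x)) t - δ else -1 with hΦ
  have hΦm : ∀ k t, Measurable fun x => Φ k x t := by
    intro k t
    refine Measurable.ite hs (Measurable.sub_const ?_ δ) measurable_const
    refine Measurable.limsup fun N => ?_
    refine Measurable.div_const (Finset.measurable_fun_sum _ fun n _ => ?_) _
    refine Measurable.norm (Measurable.const_mul (Finset.measurable_fun_sum _ fun h _ => ?_) _)
    exact (hfT (n + h)).const_mul _
  have hΦc : ∀ k x, Continuous (Φ k x) := by
    intro k x
    by_cases hx : x ∈ s
    · have : Φ k x = fun t => F (k + 1) (fun n => f (T^[n] x)) t - δ := by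
        funext t; simp [hΦ, hx]
      rw [this]
      exact (F_cont (hnice x hx) _).sub continuous_const
    · have : Φ k x = fun t => -1 := by funext t; simp [hΦ, hx]
      rw [this]
      exact continuous_const
  obtain ⟨θ, hθm, hθ, hθc⟩ := selection Φ hΦm hΦc (-R) R
  have hinv : ∀ᵐ x ∂ν, θ (T x) = θ x := by
    filter_upwards [hs1, hT.quasiMeasurePreserving.ae hs1] with x h1 h2
    refine hθc _ _ fun k t => ?_
    simp only [hΦ, h1, h2, if_true]
    have := F_shift (hnice x h1) (hnice (T x) h2) (k + 1) t
    simp only [Function.iterate_succ_apply] at this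
    rw [← this]
  obtain ⟨U, hU1, hU⟩ := exists_twist hT hθm
  have hmem : f ∈ (U.eqLocus (1 : Lp ℂ 2 ν →L[ℂ] Lp ℂ 2 ν))ᗮ := by
    rw [Submodule.mem_orthogonal]
    intro g hg
    refine hperp g (eigen_good hT hinv R ?_)
    have hg' : U g = g := hg
    filter_upwards [hU g] with x hx
    rw [← hx, hg']
  have hmean := U.tendsto_birkhoffAverage_orthogonalProjection hU1 f
  rw [Submodule.orthogonalProjectionOnto_eq_zero_iff.2 hmem] at hmean
  have hmean' : Tendsto (fun k : ℕ => ‖birkhoffAverage ℂ U id (k + 1) f‖) atTop (nhds 0) := by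
    have := (tendsto_norm.comp hmean).comp (tendsto_add_atTop_nat 1)
    rw [ZeroMemClass.coe_zero, norm_zero] at this
    exact this
  have hae : ∀ H : ℕ, (birkhoffAverage ℂ U id H f : Lp ℂ 2 ν) =ᵐ[ν]
      fun x => (H : ℂ)⁻¹ * ∑ h ∈ Finset.range H, Complex.exp (θ x * h * Complex.I) * f (T^[h] x) := by
    intro H
    have h1 := ae_all_iff.2 fun n => twist_iter hT hinv hU f n
    rw [birkhoffAverage, birkhoffSum]
    filter_upwards [Lp.coeFn_smul (H : ℂ)⁻¹ (∑ k ∈ Finset.range H, id (U^[k] f)),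
      Lp.coeFn_fun_finsetSum (Finset.range H) (fun k => id (U^[k] f)), h1] with x a1 a2 a3
    rw [a1, Pi.smul_apply, a2, smul_eq_mul]
    congr 1
    exact Finset.sum_congr rfl fun n _ => a3 n
  have hlim : Tendsto (fun k : ℕ => ENNReal.ofReal (‖birkhoffAverage ℂ U id (k + 1) f‖ / (δ / 2)))
      atTop (nhds 0) := by
    rw [← ENNReal.ofReal_zero]
    refine ENNReal.tendsto_ofReal ?_
    simpa using hmean'.div_const (δ / 2)
  refine le_antisymm (ge_of_tendsto' hlim fun k => ?_) zero_le
  set B : Lp ℂ 2 ν := birkhoffAverage ℂ U id (k + 1) f with hB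
  have hBi : Integrable (fun x => ‖B x‖) ν := ((Lp.memLp B).integrable (by norm_num)).norm
  have hmax := max_ineq hT hBi (fun x => norm_nonneg _) (half_pos hδ)
  refine le_trans (measure_mono_ae ?_) (hmax.trans ?_)
  · filter_upwards [ae_iterate hT hinv, ae_iterate hT (hae (k + 1))] with x h1 h2
    rintro ⟨hxs, hx⟩
    have hθn : ∀ n, θ (T^[n] x) = θ x := by
      intro n
      induction n with
      | zero => rfl
      | succ n ih => rw [Function.iterate_succ_apply', h1 n, ih]
    have h3 := hθ x (by
      obtain ⟨t, ht, htk⟩ := hx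
      exact ⟨t, ht, fun k => by simp only [hΦ, hxs, if_true]; linarith [htk k]⟩) k
    simp only [hΦ, hxs, if_true] at h3
    have hBW : ∀ n, ‖B (T^[n] x)‖ = W (k + 1) (fun n => f (T^[n] x)) (θ x) n := by
      intro n
      rw [hB, h2 n, W, hθn]
      simp only [← Function.iterate_add_apply, add_comm n]
    have h4 : δ / 2 < F (k + 1) (fun n => f (T^[n] x)) (θ x) := by linarith
    have h5 := frequently_lt_of_lt_limsup (avg_cobdd _ _ _) h4
    obtain ⟨N, hN, hN1⟩ := (h5.and_eventually (eventually_ge_atTop 1)).exists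
    refine ⟨N, ?_⟩
    have hN' : (0 : ℝ) < N := by exact_mod_cast hN1
    rw [lt_div_iff₀ hN'] at hN
    simpa only [hBW] using hN
  · refine ENNReal.ofReal_le_ofReal (div_le_div_of_nonneg_right ?_ (half_pos hδ).le)
    exact (l1_le_l2 (Lp.memLp B)).trans (le_of_eq (Lp.norm_def B).symm)

lemma perp_good {ν : Measure X} [IsProbabilityMeasure ν] {T : X → X}
    (hT : MeasurePreserving T ν ν) {R : ℝ} (f : Lp ℂ 2 ν)
    (hperp : ∀ g : Lp ℂ 2 ν, Good ν T R g → inner ℂ g f = 0) : Good ν T R f := by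
  obtain ⟨s', hs', hs'm, hs'0⟩ := exists_measurable_superset_of_null (ae_iff.1 (nice_ae hT (Lp.memLp f)))
  have hs1 : ∀ᵐ x ∂ν, x ∈ s'ᶜ := by rw [ae_iff]; simpa using hs'0
  have hnice : ∀ x ∈ s'ᶜ, Nice (fun n => f (T^[n] x)) := fun x hx => by
    by_contra h
    exact hx (hs' h)
  have hnull := ae_all_iff.2 fun m : ℕ => measure_eq_zero_iff_ae_notMem.1
    (perp_null hT f hperp hs'm.compl hs1 hnice (δ := 1 / ((m : ℝ) + 1)) (by positivity))
  filter_upwards [hs1, hnull] with x h1 h2 t ht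
  refine ⟨0, Metric.tendsto_nhds.2 fun ε hε => ?_⟩
  obtain ⟨m, hm⟩ := exists_nat_one_div_lt (half_pos hε)
  have h3 : ∃ k : ℕ, F (k + 1) (fun n => f (T^[n] x)) t < 1 / ((m : ℝ) + 1) := by
    by_contra hcon
    push Not at hcon
    exact h2 m ⟨h1, t, ht, hcon⟩
  obtain ⟨k, hk⟩ := h3
  filter_upwards [ctrl (hnice x h1) (Nat.succ_pos k) (half_pos hε) (hk.trans hm)] with N hN
  rw [dist_zero_right]
  linarith

lemma good_l2 {ν : Measure X} [IsProbabilityMeasure ν] {T : X → X}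
    (hT : MeasurePreserving T ν ν) (R : ℝ) (f : Lp ℂ 2 ν) : Good ν T R f := by
  let K : Submodule ℂ (Lp ℂ 2 ν) :=
    { carrier := {g | Good ν T R g}
      add_mem' := fun {f g} hf hg => (Good.add hf hg).congr hT (Lp.coeFn_add f g).symm
      zero_mem' := by
        refine Good.congr hT (Lp.coeFn_zero ℂ 2 ν).symm (Eventually.of_forall fun x t _ => ⟨0, ?_⟩)
        simp
      smul_mem' := fun c f hf => (Good.smul c hf).congr hT (Lp.coeFn_smul c f).symm }
  have hK : Kᗮ = ⊥ := by
    rw [eq_bot_iff]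
    intro g hg
    have h1 : g ∈ K := perp_good hT g fun h hh => (Submodule.mem_orthogonal K g).1 hg h hh
    have := (Submodule.mem_orthogonal K g).1 hg g h1
    simpa using this
  have htop := Submodule.topologicalClosure_eq_top_iff.2 hK
  have hfc : f ∈ closure (K : Set (Lp ℂ 2 ν)) := by
    rw [← Submodule.topologicalClosure_coe, htop]; trivial
  refine Good.closed hT ((Lp.memLp f).integrable (by norm_num)) fun ε hε => ?_
  obtain ⟨g, hg, hd⟩ := Metric.mem_closure_iff.1 hfc ε hε
  refine ⟨g, (Lp.memLp g).integrable (by norm_num), hg, ?_⟩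
  have h1 := l1_le_l2 ((Lp.memLp f).sub (Lp.memLp g))
  refine h1.trans ?_
  rw [← Lp.dist_def]
  exact hd.le

lemma good_l1 {ν : Measure X} [IsProbabilityMeasure ν] {T : X → X}
    (hT : MeasurePreserving T ν ν) (R : ℝ) {f : X → ℂ} (hf : Integrable f ν) : Good ν T R f := by
  refine Good.closed hT hf fun ε hε => ?_
  obtain ⟨g, hg, hg1⟩ := (memLp_one_iff_integrable.2 hf).exists_simpleFunc_eLpNorm_sub_lt
    (by norm_num) (ε := ENNReal.ofReal ε) (by simpa using hε)
  have hg2 := SimpleFunc.memLp_of_isFiniteMeasure g 2 ν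
  refine ⟨g, memLp_one_iff_integrable.1 hg1,
    (good_l2 hT R (hg2.toLp g)).congr hT hg2.coeFn_toLp, ?_⟩
  have hi : Integrable (f - ⇑g) ν := hf.sub (memLp_one_iff_integrable.1 hg1)
  have := integral_norm_eq_lintegral_enorm hi.1
  rw [← eLpNorm_one_eq_lintegral_enorm] at this
  simp only [Pi.sub_apply] at this
  rw [this]
  exact ENNReal.toReal_le_of_le_ofReal hε.le hg.le

lemma sum_split (N : ℕ) (u : ℤ → ℂ) : ∑ n ∈ Finset.Icc (-(N : ℤ)) N, u n =
    ∑ n ∈ Finset.range (N + 1), u n + ∑ n ∈ Finset.range (N + 1), u (-n) - u 0 := by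
  induction N with
  | zero => simp
  | succ N ih =>
    rw [Nat.cast_add, Nat.cast_one, Finset.Icc_succ_succ, Finset.sum_union (by simp),
      Finset.sum_pair (by lia), ih, Finset.sum_range_succ _ (N + 1), Finset.sum_range_succ _ (N + 1)]
    push_cast
    ring_nf
end WW

theorem stmt0 {X : Type*} [MeasurableSpace X] (ν : Measure X) [IsProbabilityMeasure ν]
    (T : Equiv.Perm X)
    (hT : MeasurePreserving T ν ν) (hTinv : MeasurePreserving T.symm ν ν)
    (f : X → ℂ) (hf : Integrable f ν) :
    ∃ Xf : Set X, ν Xfᶜ = 0 ∧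
      ∀ θ ∈ Set.Icc (0 : ℝ) (2 * Real.pi), ∀ x ∈ Xf, ∃ L : ℂ,
        Tendsto (fun N : ℕ => ((2 * N + 1 : ℕ) : ℂ)⁻¹ *
            ∑ n ∈ Finset.Icc (-(N : ℤ)) (N : ℤ),
              Complex.exp (θ * n * Complex.I) * f ((T ^ n) x))
          atTop (nhds L) := by
  have h1 := WW.good_l1 hT (2 * Real.pi) hf
  have h2 := WW.good_l1 hTinv (2 * Real.pi) hf
  refine ⟨{x | WW.Conv (2 * Real.pi) (fun n => f (T^[n] x)) ∧
    WW.Conv (2 * Real.pi) (fun n => f (T.symm^[n] x))}, h1.and h2, ?_⟩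
  rintro θ hθ x ⟨hx1, hx2⟩
  have hpi := Real.pi_pos
  obtain ⟨L1, hL1⟩ := hx1 θ ⟨by linarith [hθ.1], hθ.2⟩
  obtain ⟨L2, hL2⟩ := hx2 (-θ) ⟨by linarith [hθ.2], by linarith [hθ.1]⟩
  have hL := (hL1.add hL2).comp (tendsto_add_atTop_nat 1)
  have hr : Tendsto (fun N : ℕ => (((2 * N + 1 : ℕ) : ℂ))⁻¹) atTop (nhds 0) :=
    (tendsto_inv_atTop_nhds_zero_nat (𝕜 := ℂ)).comp
      (tendsto_atTop_mono (fun N => by simp only [id]; lia) tendsto_id)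
  have hq : Tendsto (fun N : ℕ => (((2 * N + 1 : ℕ) : ℂ))⁻¹ * ((N + 1 : ℕ) : ℂ)) atTop
      (nhds (1 / 2 + 0 * (1 / 2))) := by
    refine (tendsto_const_nhds.add (hr.mul_const (1 / 2))).congr fun N => ?_
    have : ((2 * N + 1 : ℕ) : ℂ) ≠ 0 := Nat.cast_ne_zero.2 (by lia)
    push_cast at this ⊢
    field_simp
    ring
  refine ⟨_, ((hq.mul hL).sub (hr.mul_const (f x))).congr fun N => ?_⟩
  rw [WW.sum_split]
  have hN : ((N + 1 : ℕ) : ℂ) ≠ 0 := Nat.cast_ne_zero.2 (by lia)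
  have e1 : ∀ n : ℕ, (T ^ (n : ℤ)) x = T^[n] x := fun n => by
    rw [zpow_natCast, Equiv.Perm.iterate_eq_pow]
  have e2 : ∀ n : ℕ, (T ^ (-(n : ℤ))) x = T.symm^[n] x := fun n => by
    rw [zpow_neg, zpow_natCast, ← inv_pow, ← Equiv.Perm.iterate_eq_pow]; rfl
  simp only [e1, e2, Function.comp]
  rw [← mul_add, mul_assoc, mul_inv_cancel_left₀ hN]
  simp
  ring
end

section
/- Let (X,ρ,μ) be a 𝐝-dimensional metric measure space, 𝒬 a collection of real-valued continuous functions on X, K an α-kernel on X, and r > 2. Define, for f ∈ L¹_loc(X,μ), M_{T_b}f(x) := sup over balls B containing x and over x',x'' ∈ B of sup_{Q∈𝒬} ( |S_1(K,Q,f·1_{X∖3B})(x') − S_1(K,Q,f·1_{X∖3B})(x'')| + ‖S_u(K,Q,f·1_{X∖3B})(x') − S_u(K,Q,f·1_{X∖3B})(x'')‖_{V^r_u} ), and M_{T_a}f(x) analogously with A_u(Q,f·1_{X∖3B}) in place of S_u(K,Q,f·1_{X∖3B}). Then there exists a constant C such that for all f: M_{T_a}f(x) + M_{T_b}f(x) ≤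 C (M(|f|^{4/3})(x))^{3/4} for all x ∈ X. -/
open MeasureTheory Metric Complex Filter Set
open scoped ENNReal NNReal

noncomputable section

/-- `e(t) = e^{it}`. -/
def expi (t : ℝ) : ℂ := Complex.exp (t * Complex.I)

/-- The `r`-variation seminorm (valued in `ℝ≥0∞`) of `a : ℝ → ℂ` along the index set `I`. -/
def vNorm (r : ℝ) (I : Set ℝ) (a : ℝ → ℂ) : ℝ≥0∞ :=
  ⨆ (N : ℕ) (t : ℕ → ℝ) (_ : ∀ n, n ≤ N → t n ∈ I) (_ : ∀ n, n < N → t n < t (n + 1)),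
    (∑ n ∈ Finset.range N, (‖a (t (n + 1)) - a (t n)‖₊ : ℝ≥0∞) ^ r) ^ (1 / r)

/-- The `L^p` norm of an `ℝ≥0∞`-valued function. -/
def lpNormENN {X : Type*} [MeasurableSpace X] (p : ℝ) (μ : Measure X) (g : X → ℝ≥0∞) : ℝ≥0∞ :=
  (∫⁻ x, g x ^ p ∂μ) ^ (1 / p)

/-- `d_B(f,g) = sup_{x,y ∈ B} |f(x)-f(y)-g(x)+g(y)|`. -/
def dB {X : Type*} (B : Set X) (f g : X → ℝ) : ℝ :=
  sSup ((fun q : X × X => |f q.1 - f q.2 - g q.1 + g q.2|) '' (B ×ˢ B))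

/-- Inhomogeneous Lipschitz norm `‖φ‖_{C^{0,1}(B)}` on the ball `B = B(z,R)`. -/
def c01Norm {X : Type*} [MetricSpace X] (z : X) (R : ℝ) (φ : X → ℂ) : ℝ :=
  sSup ((fun x => ‖φ x‖) '' ball z R) +
    R * sSup ((fun q : X × X => ‖φ q.1 - φ q.2‖ / dist q.1 q.2) ''
      ((ball z R ×ˢ ball z R) ∩ {q | q.1 ≠ q.2}))

/-- A compatible collection of real-valued continuous functions, with constant `C`. -/
structure IsCompatible {X : Type*} [MetricSpace X] (𝒬 : Set (X → ℝ)) (C : ℝ) : Prop where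
  cont : ∀ Q ∈ 𝒬, Continuous Q
  exists_base : ∃ x₀ : X, ∀ Q ∈ 𝒬, Q x₀ = 0
  dB_symm : ∀ (z : X) (R : ℝ), 0 < R → ∀ f ∈ 𝒬, ∀ g ∈ 𝒬,
    dB (ball z R) f g = dB (ball z R) g f
  dB_eq_zero : ∀ (z : X) (R : ℝ), 0 < R → ∀ f ∈ 𝒬, ∀ g ∈ 𝒬,
    dB (ball z R) f g = 0 → f = g
  dB_triangle : ∀ (z : X) (R : ℝ), 0 < R → ∀ f ∈ 𝒬, ∀ g ∈ 𝒬, ∀ h ∈ 𝒬,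
    dB (ball z R) f h ≤ dB (ball z R) f g + dB (ball z R) g h
  dB_doubling : ∀ (x₁ x₂ : X) (R : ℝ), 0 < R → x₁ ∈ ball x₂ (2 * R) →
    ∀ f ∈ 𝒬, ∀ g ∈ 𝒬, dB (ball x₂ (2 * R)) f g ≤ C * dB (ball x₁ R) f g
  dB_growth : ∀ (x₁ x₂ : X) (R : ℝ), 0 < R → ball x₁ R ⊆ ball x₂ (C * R) →
    ∀ f ∈ 𝒬, ∀ g ∈ 𝒬, 2 * dB (ball x₁ R) f g ≤ dB (ball x₂ (C * R)) f g
  dB_covering : ∀ (z : X) (R : ℝ), 0 < R → ∀ (R' : ℝ), 0 < R' → ∀ f₀ ∈ 𝒬,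
    ∃ F : Finset (X → ℝ), ↑F ⊆ 𝒬 ∧ (F.card : ℝ) ≤ C ∧
      ∀ g ∈ 𝒬, dB (ball z R) f₀ g ≤ 2 * R' → ∃ h ∈ F, dB (ball z R) h g ≤ R'

/-- The collection `𝒬` is `ε`-cancellative with constant `C`, on a `D`-dimensional space. -/
def IsCancellative {X : Type*} [MetricSpace X] [MeasurableSpace X] (μ : Measure X) (D : ℝ)
    (𝒬 : Set (X → ℝ)) (ε C : ℝ) : Prop :=
  ∀ (z : X) (R : ℝ), 0 < R → ∀ φ : X → ℂ, (∃ L, LipschitzWith L φ) →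
    Function.support φ ⊆ ball z R → ∀ f ∈ 𝒬, ∀ g ∈ 𝒬,
      ‖∫ x in ball z R, expi (f x - g x) * φ x ∂μ‖ ≤
        C * R ^ D * c01Norm z R φ * (1 + dB (ball z R) f g) ^ (-ε)

/-- `α`-kernel on a `D`-dimensional metric measure space. -/
def IsAlphaKernel {X : Type*} [MetricSpace X] [MeasurableSpace X] (D α : ℝ)
    (K : X → X → ℂ) : Prop :=
  Measurable (Function.uncurry K) ∧
  (∀ x y : X, x ≠ y → ‖K x y‖ ≤ dist x y ^ (-D)) ∧
  (∀ x y y' : X, 2 * dist y y' ≤ dist x y →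
    ‖K x y - K x y'‖ + ‖K y x - K y' x‖ ≤ (dist y y' / dist x y) ^ α * dist x y ^ (-D))

/-- One-sided `α`-kernel. -/
def IsOneSidedKernel {X : Type*} [MetricSpace X] [MeasurableSpace X] (D α : ℝ)
    (K : X → X → ℂ) : Prop :=
  Measurable (Function.uncurry K) ∧
  (∀ x y : X, x ≠ y → ‖K x y‖ ≤ dist x y ^ (-D)) ∧
  (∀ x y y' : X, 2 * dist y y' ≤ dist x y →
    ‖K x y - K x y'‖ ≤ (dist y y' / dist x y) ^ α * dist x y ^ (-D))

/-- The cancellation condition for a kernel `K`. -/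
def CancelCond {X : Type*} [MetricSpace X] [MeasurableSpace X] (μ : Measure X)
    (K : X → X → ℂ) : Prop :=
  ∀ (x : X) (R₁ R₂ : ℝ), 0 < R₁ → R₁ < R₂ →
    (∫ y in ball x R₂ \ ball x R₁, K x y ∂μ) = 0 ∧
    (∫ y in ball x R₂ \ ball x R₁, K y x ∂μ) = 0

/-- Truncated modulated singular integral `S_u(K,Q,f)(x)`. -/
def singOp {X : Type*} [MetricSpace X] [MeasurableSpace X] (μ : Measure X) (K : X → X → ℂ)
    (u : ℝ) (Q : X → ℝ) (f : X → ℂ) (x : X) : ℂ :=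
  ∫ y in {y | u < dist x y}, K x y * f y * expi (Q y) ∂μ

/-- Truncated modulated average `A_R(Q,f)(x)`. -/
def avgOp {X : Type*} [MetricSpace X] [MeasurableSpace X] (μ : Measure X)
    (R : ℝ) (Q : X → ℝ) (f : X → ℂ) (x : X) : ℂ :=
  (μ (ball x R)).toReal⁻¹ • ∫ y in ball x R, f y * expi (Q y) ∂μ

/-- `ζ^δ(x) = log(1+δ)⁻¹ 1_{[1,1+δ]}(x)`. -/
def zetaD (δ x : ℝ) : ℝ := (Real.log (1 + δ))⁻¹ * (Set.Icc 1 (1 + δ)).indicator 1 x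

/-- `(ζ^δ)_t(x) = t⁻¹ ζ^δ(x/t)`. -/
def zetaDt (δ t x : ℝ) : ℝ := t⁻¹ * zetaD δ (x / t)

/-- `Z^δ_{a,b}(x) = ∫_a^b (ζ^δ)_t(x) dt`. -/
def Zcut (δ a b x : ℝ) : ℝ := ∫ t in a..b, zetaDt δ t x

/-- `Z^δ_{a,∞}(x) = ∫_a^∞ (ζ^δ)_t(x) dt`. -/
def ZcutInf (δ a x : ℝ) : ℝ := ∫ t in Set.Ioi a, zetaDt δ t x

/-- `δ`-smoothly truncated modulated singular integral `S^δ_u(K,Q,f)(x)`. -/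
def singOpD {X : Type*} [MetricSpace X] [MeasurableSpace X] (μ : Measure X) (K : X → X → ℂ)
    (δ u : ℝ) (Q : X → ℝ) (f : X → ℂ) (x : X) : ℂ :=
  ∫ y, (ZcutInf δ u (dist x y) : ℂ) * K x y * f y * expi (Q y) ∂μ

/-- `δ`-smoothly truncated modulated average `A^δ_R(Q,f)(x)` on a `D`-dimensional space. -/
def avgOpD {X : Type*} [MetricSpace X] [MeasurableSpace X] (μ : Measure X) (D : ℝ)
    (δ R : ℝ) (Q : X → ℝ) (f : X → ℂ) (x : X) : ℂ :=
  (R ^ (-D) : ℝ) • ∫ y, (Zcut δ 0 R (dist x y) : ℂ) * f y * expi (Q y) ∂μ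

/-- `M(|f|^s)(x)`, the Hardy–Littlewood maximal function of `|f|^s`. -/
def maxFn {X : Type*} [MetricSpace X] [MeasurableSpace X] (μ : Measure X) (s : ℝ)
    (f : X → ℂ) (x : X) : ℝ≥0∞ :=
  ⨆ (R : ℝ) (_ : 0 < R), (μ (ball x R))⁻¹ * ∫⁻ y in ball x R, (‖f y‖₊ : ℝ≥0∞) ^ s ∂μ

variable {X : Type*} [MetricSpace X] [CompleteSpace X] [MeasurableSpace X] [BorelSpace X]

def MTb (μ : Measure X) (𝒬 : Set (X → ℝ)) (K : X → X → ℂ) (r : ℝ) (f : X → ℂ)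
    (x : X) : ℝ≥0∞ :=
  ⨆ (z : X) (t : ℝ) (_ : 0 < t) (_ : x ∈ ball z t) (x' : X) (_ : x' ∈ ball z t)
      (x'' : X) (_ : x'' ∈ ball z t) (Q : X → ℝ) (_ : Q ∈ 𝒬),
    ((‖singOp μ K 1 Q ((ball z (3 * t))ᶜ.indicator f) x'
        - singOp μ K 1 Q ((ball z (3 * t))ᶜ.indicator f) x''‖₊ : ℝ≥0∞) +
      vNorm r (Set.Ioi 0) fun u => singOp μ K u Q ((ball z (3 * t))ᶜ.indicator f) x'
        - singOp μ K u Q ((ball z (3 * t))ᶜ.indicator f) x'')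
def MTa (μ : Measure X) (𝒬 : Set (X → ℝ)) (r : ℝ) (f : X → ℂ) (x : X) : ℝ≥0∞ :=
  ⨆ (z : X) (t : ℝ) (_ : 0 < t) (_ : x ∈ ball z t) (x' : X) (_ : x' ∈ ball z t)
      (x'' : X) (_ : x'' ∈ ball z t) (Q : X → ℝ) (_ : Q ∈ 𝒬),
    ((‖avgOp μ 1 Q ((ball z (3 * t))ᶜ.indicator f) x'
        - avgOp μ 1 Q ((ball z (3 * t))ᶜ.indicator f) x''‖₊ : ℝ≥0∞) +
      vNorm r (Set.Ioi 0) fun u => avgOp μ u Q ((ball z (3 * t))ᶜ.indicator f) x'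
        - avgOp μ u Q ((ball z (3 * t))ᶜ.indicator f) x'')
theorem aux_bern {x p : ℝ} (hx : 0 ≤ x) (hx1 : x ≤ 1) (hp : 0 < p) :
    1 - x ^ p ≤ max 1 p * (1 - x) := by
  rcases le_total p 1 with h | h
  · rw [max_eq_left h]
    rcases hx.eq_or_lt with h0 | h0
    · subst h0; simp [Real.zero_rpow hp.ne']
    · have := Real.rpow_le_rpow_of_exponent_ge h0 hx1 h
      rw [Real.rpow_one] at this
      linarith
  · rw [max_eq_right h]
    have := one_add_mul_self_le_rpow_one_add (s := x - 1) (by linarith) h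
    rw [show 1 + (x - 1) = x by ring] at this
    linarith

/-- weight -/
def wt (D β t : ℝ) (z y : X) : ℝ := (t / dist z y) ^ β * dist z y ^ (-D)

theorem aux_second (μ : Measure X) (D A : ℝ) (hA : 0 < A)
    (hvol : ∀ (x : X) (R : ℝ), 0 < R → μ (ball x R) = ENNReal.ofReal (A * R ^ D)) :
    SecondCountableTopology X := by
  rcases isEmpty_or_nonempty X with he | ⟨⟨x0⟩⟩
  · infer_instance
  have hsf : SigmaFinite μ := by
    refine ⟨⟨{ set := fun n => ball x0 (n + 1), set_mem := fun _ => trivial, finite := ?_, spanning := ?_ }⟩⟩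
    · intro n
      rw [hvol _ _ (by positivity)]; exact ENNReal.ofReal_lt_top
    · refine eq_univ_of_forall fun y => ?_
      obtain ⟨n, hn⟩ := exists_nat_ge (dist y x0)
      exact mem_iUnion.2 ⟨n, by simp only [mem_ball]; linarith⟩
  refine Metric.secondCountable_of_almost_dense_set fun ε hε => ?_
  obtain ⟨s, hs⟩ := zorn_subset {s : Set X | s.Pairwise fun a b => ε < dist a b} (by
    intro c hc hch
    refine ⟨⋃₀ c, ?_, fun s hs => subset_sUnion_of_mem hs⟩
    exact (pairwise_sUnion hch.directedOn).2 fun s hs => hc hs)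
  refine ⟨s, ?_, ?_⟩
  · have := Measure.countable_meas_pos_of_disjoint_iUnion (μ := μ)
      (As := fun i : s => ball (i : X) (ε / 2)) (fun i => measurableSet_ball) (by
        intro i j hij
        apply ball_disjoint_ball
        have := hs.1 i.2 j.2 (fun h => hij (Subtype.ext h))
        linarith)
    have h2 : {i : s | 0 < μ (ball (i : X) (ε / 2))} = univ := by
      refine eq_univ_of_forall fun i => ?_
      simp only [mem_ofPred_eq]
      rw [hvol _ _ (by positivity)]
      simp only [ENNReal.ofReal_pos]; positivity
    rw [h2] at this
    exact countable_univ_iff.1 this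
  · intro x
    by_contra hcon
    push Not at hcon
    have hx : x ∉ s := fun h => by have := hcon x h; simp at this; linarith
    have h1 : insert x s ∈ {s : Set X | s.Pairwise fun a b => ε < dist a b} := by
      refine (pairwise_insert).2 ⟨hs.1, fun b hb _ => ⟨hcon b hb, by rw [dist_comm]; exact hcon b hb⟩⟩
    exact hx (hs.2 h1 (subset_insert _ _) (mem_insert _ _))

theorem aux_weight (μ : Measure X) (D A : ℝ) (hD : 0 < D) (hA : 0 < A)
    (hvol : ∀ (x : X) (R : ℝ), 0 < R → μ (ball x R) = ENNReal.ofReal (A * R ^ D))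
    (β : ℝ) (hβ : 0 < β) : ∃ C : ℝ≥0, ∀ (z : X) (t : ℝ), 0 < t → ∀ x ∈ ball z t,
      ∀ (h : X → ℝ≥0∞) (m : ℝ≥0∞),
      (∀ R > 0, ∫⁻ y in ball x R, h y ∂μ ≤ m * μ (ball x R)) →
      ∫⁻ y in (ball z (3 * t))ᶜ, ENNReal.ofReal (wt D β t z y) * h y ∂μ ≤ C * m := by
  set q : ℝ := 2 ^ (-β) with hq
  have hq0 : 0 < q := by positivity
  have hq1 : q < 1 := Real.rpow_lt_one_of_one_lt_of_neg (by norm_num) (by linarith)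
  have hsum : Summable fun k : ℕ => A * 4 ^ D * q ^ k :=
    (summable_geometric_of_lt_one hq0.le hq1).mul_left _
  refine ⟨(∑' k : ℕ, A * 4 ^ D * q ^ k).toNNReal, ?_⟩
  intro z t ht x hx h m hm
  set S : ℕ → Set X := fun k => {y | 2 ^ k * t ≤ dist z y} ∩ {y | dist z y < 2 ^ (k + 1) * t} with hS
  have hSm : ∀ k, MeasurableSet (S k) := fun k =>
    (measurableSet_le (by fun_prop) (by fun_prop)).inter (measurableSet_lt (by fun_prop) (by fun_prop))
  have hcov : (ball z (3 * t))ᶜ ⊆ ⋃ k, S k := by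
    intro y hy
    simp only [mem_compl_iff, mem_ball, not_lt, dist_comm y z] at hy
    obtain ⟨n, hn1, hn2⟩ := exists_nat_pow_near (x := dist z y / t) (y := 2)
      ((one_le_div ht).2 (by linarith)) (by norm_num)
    exact mem_iUnion.2 ⟨n, (le_div_iff₀ ht).1 hn1, (div_lt_iff₀ ht).1 hn2⟩
  calc _ ≤ ∫⁻ y in ⋃ k, S k, ENNReal.ofReal (wt D β t z y) * h y ∂μ := lintegral_mono_set hcov
    _ ≤ ∑' k, ∫⁻ y in S k, ENNReal.ofReal (wt D β t z y) * h y ∂μ := lintegral_iUnion_le _ _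
    _ ≤ ∑' k : ℕ, ENNReal.ofReal (A * 4 ^ D * q ^ k) * m := by
        refine ENNReal.tsum_le_tsum fun k => ?_
        have hk : (0:ℝ) < 2 ^ k * t := by positivity
        calc _ ≤ ∫⁻ y in S k, ENNReal.ofReal (q ^ k * (2 ^ k * t) ^ (-D)) * h y ∂μ := by
              refine setLIntegral_mono' (hSm k) fun y hy => ?_
              gcongr
              unfold wt
              have h1 : (t / dist z y) ^ β ≤ q ^ k := by
                have : t / dist z y ≤ (2 ^ k)⁻¹ := by
                  rw [div_le_iff₀ (hk.trans_le hy.1), inv_mul_eq_div, le_div_iff₀ (by positivity)]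
                  have h7 : 2 ^ k * t ≤ dist z y := hy.1
                  linarith
                refine (Real.rpow_le_rpow (by positivity) this hβ.le).trans (le_of_eq ?_)
                rw [hq, ← Real.rpow_natCast, ← Real.rpow_natCast, ← Real.rpow_neg (by norm_num),
                  ← Real.rpow_mul (by norm_num), ← Real.rpow_mul (by norm_num)]
                ring_nf
              have h2 : dist z y ^ (-D) ≤ (2 ^ k * t) ^ (-D) :=
                Real.rpow_le_rpow_of_nonpos hk hy.1 (by linarith)
              gcongr
          _ = ENNReal.ofReal (q ^ k * (2 ^ k * t) ^ (-D)) * ∫⁻ y in S k, h y ∂μ :=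
              lintegral_const_mul' _ _ ENNReal.ofReal_ne_top
          _ ≤ ENNReal.ofReal (q ^ k * (2 ^ k * t) ^ (-D)) * (m * μ (ball x (4 * (2 ^ k * t)))) := by
              gcongr
              refine (lintegral_mono_set ?_).trans (hm _ (by positivity))
              intro y hy
              have h1 := dist_triangle y z x
              have h2 : dist z y < 2 ^ (k + 1) * t := hy.2
              rw [dist_comm y z] at h1
              rw [mem_ball, dist_comm] at hx
              have h3 : t ≤ 2 ^ k * t := le_mul_of_one_le_left ht.le (one_le_pow₀ (by norm_num))
              rw [mem_ball]
              rw [pow_succ] at h2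
              nlinarith
          _ = _ := by
              rw [hvol _ _ (by positivity), mul_comm m, ← mul_assoc, ← ENNReal.ofReal_mul (by positivity)]
              congr 2
              rw [Real.mul_rpow (by norm_num) hk.le, Real.rpow_neg hk.le]
              have : (2 ^ k * t) ^ D ≠ 0 := by positivity
              field_simp
    _ = _ := by
        rw [ENNReal.tsum_mul_right, ← ENNReal.ofReal_tsum_of_nonneg (fun k => by positivity) hsum]
        rfl

theorem aux_shell (μ : Measure X) (D A : ℝ) (hD : 0 < D) (hA : 0 < A)
    (hvol : ∀ (x : X) (R : ℝ), 0 < R → μ (ball x R) = ENNReal.ofReal (A * R ^ D)) :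
    ∃ C : ℝ≥0, ∀ (z : X) (t : ℝ), 0 < t → ∀ p ∈ ball z t, ∀ u : ℝ,
      ∫⁻ y in (ball z (3 * t))ᶜ ∩ {y | |dist p y - u| ≤ 2 * t},
        ENNReal.ofReal (dist z y ^ (-D) * (dist z y / t)) ∂μ ≤ C := by
  refine ⟨(3 ^ (-D) * 9 * (A * 10 ^ D)
    + (1 / 2) ^ (-D) * (3 / 2) * (A * ((3 / 2) ^ D * (max 1 D * 5)))).toNNReal, ?_⟩
  intro z t ht p hp u
  set E := (ball z (3 * t))ᶜ ∩ {y | |dist p y - u| ≤ 2 * t} with hE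
  have hEm : MeasurableSet E :=
    measurableSet_ball.compl.inter (measurableSet_le (by fun_prop) (by fun_prop))
  rw [mem_ball] at hp
  have key : ∀ y ∈ E, 3 * t ≤ dist z y ∧ u - 3 * t ≤ dist z y ∧ dist z y ≤ u + 3 * t := by
    rintro y ⟨h1, h2⟩
    simp only [mem_compl_iff, mem_ball, not_lt, dist_comm y z] at h1
    simp only [mem_ofPred_eq, abs_le] at h2
    have h3 := dist_triangle p z y
    have h4 := dist_triangle z p y
    rw [dist_comm z p] at h4
    exact ⟨h1, by linarith, by linarith⟩
  have main : ∀ c v : ℝ, 0 ≤ c → 0 ≤ v →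
      (∀ y ∈ E, dist z y ^ (-D) * (dist z y / t) ≤ c) → μ E ≤ ENNReal.ofReal v →
      ∫⁻ y in E, ENNReal.ofReal (dist z y ^ (-D) * (dist z y / t)) ∂μ ≤ ENNReal.ofReal (c * v) := by
    intro c v hc hv h1 h2
    calc _ ≤ ∫⁻ y in E, ENNReal.ofReal c ∂μ :=
          setLIntegral_mono' hEm fun y hy => ENNReal.ofReal_le_ofReal (h1 y hy)
      _ = ENNReal.ofReal c * μ E := setLIntegral_const _ _
      _ ≤ ENNReal.ofReal c * ENNReal.ofReal v := by gcongr
      _ = _ := (ENNReal.ofReal_mul hc).symm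
  have hmax : 0 < max 1 D := by positivity
  rcases le_or_gt u (6 * t) with hu | hu
  · refine (main ((3 * t) ^ (-D) * 9) (A * (10 * t) ^ D) (by positivity) (by positivity) ?_ ?_).trans ?_
    · intro y hy
      obtain ⟨h1, h2, h3⟩ := key y hy
      have h4 : dist z y ^ (-D) ≤ (3 * t) ^ (-D) :=
        Real.rpow_le_rpow_of_nonpos (by positivity) h1 (by linarith)
      have h5 : dist z y / t ≤ 9 := by rw [div_le_iff₀ ht]; linarith
      gcongr
    · rw [← hvol z _ (by positivity)]
      refine measure_mono fun y hy => ?_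
      obtain ⟨h1, h2, h3⟩ := key y hy
      rw [mem_ball, dist_comm]; linarith
    · refine ENNReal.ofReal_le_ofReal ?_
      rw [Real.mul_rpow (by norm_num) ht.le, Real.mul_rpow (by norm_num) ht.le, Real.rpow_neg ht.le]
      have : t ^ D ≠ 0 := by positivity
      have : 3 ^ (-D) * (t ^ D)⁻¹ * 9 * (A * (10 ^ D * t ^ D)) = 3 ^ (-D) * 9 * (A * 10 ^ D) := by
        field_simp
      rw [this]
      have : 0 ≤ (1 / 2 : ℝ) ^ (-D) * (3 / 2) * (A * ((3 / 2) ^ D * (max 1 D * 5))) := by positivity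
      linarith
  · have hu0 : 0 < u := by linarith
    refine (main ((1 / 2 * u) ^ (-D) * (3 / 2 * u / t)) (A * ((3 / 2 * u) ^ D * (max 1 D * (5 * t / u))))
      (by positivity) (by positivity) ?_ ?_).trans ?_
    · intro y hy
      obtain ⟨h1, h2, h3⟩ := key y hy
      have h4 : dist z y ^ (-D) ≤ (1 / 2 * u) ^ (-D) :=
        Real.rpow_le_rpow_of_nonpos (by positivity) (by linarith) (by linarith)
      have h5 : dist z y ≤ 3 / 2 * u := by linarith
      gcongr
    · have hsub : E ⊆ ball p (u + 3 * t) \ ball p (u - 2 * t) := by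
        rintro y ⟨h1, h2⟩
        simp only [mem_ofPred_eq, abs_le] at h2
        simp only [Set.mem_sdiff, mem_ball, not_lt, dist_comm y p]
        constructor <;> linarith
      refine (measure_mono hsub).trans ?_
      rw [measure_sdiff (ball_subset_ball (by linarith)) measurableSet_ball.nullMeasurableSet
        (by rw [hvol _ _ (by linarith)]; exact ENNReal.ofReal_ne_top), hvol _ _ (by linarith),
        hvol _ _ (by linarith), ← ENNReal.ofReal_sub _ (by have : 0 < u - 2 * t := by linarith
                                                           positivity)]
      refine ENNReal.ofReal_le_ofReal ?_
      rw [← mul_sub]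
      refine mul_le_mul_of_nonneg_left ?_ hA.le
      have hb : 0 < u + 3 * t := by linarith
      have ha : 0 < u - 2 * t := by linarith
      have h1 := aux_bern (x := (u - 2 * t) / (u + 3 * t)) (p := D) (by positivity)
        ((div_le_one hb).2 (by linarith)) hD
      have h2 : 1 - (u - 2 * t) / (u + 3 * t) ≤ 5 * t / u := by
        rw [show 1 - (u - 2 * t) / (u + 3 * t) = 5 * t / (u + 3 * t) by field_simp; ring]
        gcongr; linarith
      rw [Real.div_rpow ha.le hb.le] at h1
      have h3 : (u + 3 * t) ^ D - (u - 2 * t) ^ D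
          = (u + 3 * t) ^ D * (1 - (u - 2 * t) ^ D / (u + 3 * t) ^ D) := by
        have : (u + 3 * t) ^ D ≠ 0 := by positivity
        field_simp
      rw [h3]
      have h4 : (u + 3 * t) ^ D ≤ (3 / 2 * u) ^ D :=
        Real.rpow_le_rpow hb.le (by linarith) hD.le
      have h5 : 1 - (u - 2 * t) ^ D / (u + 3 * t) ^ D ≤ max 1 D * (5 * t / u) :=
        h1.trans (by gcongr)
      calc _ ≤ (u + 3 * t) ^ D * (max 1 D * (5 * t / u)) := by gcongr
        _ ≤ _ := by gcongr
    · refine ENNReal.ofReal_le_ofReal ?_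
      rw [Real.mul_rpow (by norm_num) hu0.le, Real.mul_rpow (by norm_num) hu0.le, Real.rpow_neg hu0.le]
      have : u ^ D ≠ 0 := by positivity
      have : (1 / 2) ^ (-D) * (u ^ D)⁻¹ * (3 / 2 * u / t) *
          (A * ((3 / 2) ^ D * u ^ D * (max 1 D * (5 * t / u))))
          = (1 / 2) ^ (-D) * (3 / 2) * (A * ((3 / 2) ^ D * (max 1 D * 5))) := by
        field_simp
      rw [this]
      have : 0 ≤ (3 : ℝ) ^ (-D) * 9 * (A * 10 ^ D) := by positivity
      linarith

theorem aux_sum_rpow (s : Finset ℕ) (b : ℕ → ℝ≥0∞) {q : ℝ} (hq : 1 ≤ q) :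
    ∑ n ∈ s, b n ^ q ≤ (∑ n ∈ s, b n) ^ q := by
  classical
  induction s using Finset.induction_on with
  | empty => simp
  | insert a s ha ih =>
    rw [Finset.sum_insert ha, Finset.sum_insert ha]
    exact (add_le_add le_rfl ih).trans (ENNReal.add_rpow_le_rpow_add _ _ hq)

theorem aux_vnorm {r : ℝ} (hr : 2 < r) (a : ℝ → ℂ) (P P' : ℝ≥0∞)
    (h : ∀ (N : ℕ) (t : ℕ → ℝ), (∀ n, n ≤ N → 0 < t n) → (∀ n, n < N → t n < t (n + 1)) →
      ∃ U V : ℕ → ℝ≥0∞, (∀ n, n < N → ‖a (t (n + 1)) - a (t n)‖ₑ ≤ U n + V n) ∧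
        ∑ n ∈ Finset.range N, U n ≤ P ∧
        ∑ n ∈ Finset.range N, V n ^ (4 / 3 : ℝ) ≤ P' ^ (4 / 3 : ℝ)) :
    vNorm r (Set.Ioi 0) a ≤ P + P' := by
  unfold vNorm
  refine iSup_le fun N => iSup_le fun t => iSup_le fun h1 => iSup_le fun h2 => ?_
  obtain ⟨U, V, hUV, hU, hV⟩ := h N t (fun n hn => h1 n hn) h2
  have hr0 : 0 < r := by linarith
  calc _ ≤ (∑ n ∈ Finset.range N, (U n + V n) ^ r) ^ (1 / r) := by
        gcongr with n hn
        exact hUV n (Finset.mem_range.1 hn)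
    _ ≤ (∑ n ∈ Finset.range N, U n ^ r) ^ (1 / r) + (∑ n ∈ Finset.range N, V n ^ r) ^ (1 / r) :=
        ENNReal.Lp_add_le _ _ _ (by linarith)
    _ ≤ P + P' := by
        gcongr
        · calc _ ≤ ((∑ n ∈ Finset.range N, U n) ^ r) ^ (1 / r) := by
                gcongr
                exact aux_sum_rpow _ _ (by linarith)
            _ = ∑ n ∈ Finset.range N, U n := by
                rw [← ENNReal.rpow_mul, mul_one_div_cancel hr0.ne', ENNReal.rpow_one]
            _ ≤ P := hU
        · calc _ = (∑ n ∈ Finset.range N, (V n ^ (4 / 3 : ℝ)) ^ (r * (3 / 4))) ^ (1 / r) := by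
                congr 1
                refine Finset.sum_congr rfl fun n _ => ?_
                rw [← ENNReal.rpow_mul]; congr 1; ring
            _ ≤ ((∑ n ∈ Finset.range N, V n ^ (4 / 3 : ℝ)) ^ (r * (3 / 4))) ^ (1 / r) := by
                gcongr
                exact aux_sum_rpow _ _ (by linarith)
            _ ≤ ((P' ^ (4 / 3 : ℝ)) ^ (r * (3 / 4))) ^ (1 / r) := by gcongr
            _ = P' := by
                rw [← ENNReal.rpow_mul, ← ENNReal.rpow_mul]
                convert ENNReal.rpow_one P' using 2
                field_simp

theorem aux_holder {Y : Type*} [MeasurableSpace Y] (ν : Measure Y) (φ v w b : Y → ℝ≥0∞)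
    (hφ : AEMeasurable φ ν) (hw : AEMeasurable w ν) (hb : AEMeasurable b ν)
    (hv : ∀ᵐ y ∂ν, v y ≤ w y ^ (3 / 4 : ℝ) * b y ^ (1 / 4 : ℝ)) :
    ∫⁻ y, v y * φ y ∂ν ≤ (∫⁻ y, w y * φ y ^ (4 / 3 : ℝ) ∂ν) ^ (3 / 4 : ℝ)
      * (∫⁻ y, b y ∂ν) ^ (1 / 4 : ℝ) := by
  have hpq : (4 / 3 : ℝ).HolderConjugate 4 := by
    rw [Real.holderConjugate_iff]; norm_num
  have key := ENNReal.lintegral_mul_le_Lp_mul_Lq ν hpq (f := fun y => w y ^ (3 / 4 : ℝ) * φ y)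
    (g := fun y => b y ^ (1 / 4 : ℝ)) ((hw.pow_const _).mul hφ) (hb.pow_const _)
  calc _ ≤ ∫⁻ y, ((fun y => w y ^ (3 / 4 : ℝ) * φ y) * fun y => b y ^ (1 / 4 : ℝ)) y ∂ν := by
        refine lintegral_mono_ae (hv.mono fun y hy => ?_)
        calc _ ≤ w y ^ (3 / 4 : ℝ) * b y ^ (1 / 4 : ℝ) * φ y := by gcongr
          _ = _ := by simp only [Pi.mul_apply]; ring
    _ ≤ _ := key
    _ = _ := by
        congr 2
        · refine lintegral_congr fun y => ?_
          rw [ENNReal.mul_rpow_of_nonneg _ _ (by norm_num), ← ENNReal.rpow_mul]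
          norm_num
        · norm_num
        · refine lintegral_congr fun y => ?_
          rw [← ENNReal.rpow_mul]
          norm_num

theorem aux_intdiff {Y : Type*} [MeasurableSpace Y] (ν : Measure Y) (G' G'' : Y → ℂ)
    (S' S'' : Set Y) (hS' : MeasurableSet S') (hS'' : MeasurableSet S'')
    (hm' : AEStronglyMeasurable G' ν) (hm'' : AEStronglyMeasurable G'' ν)
    (h' : IntegrableOn G' S' ν) (h'' : IntegrableOn G'' S'' ν) :
    ‖(∫ y in S', G' y ∂ν) - ∫ y in S'', G'' y ∂ν‖ₑ ≤
      (∫⁻ y in S', ‖G' y - G'' y‖ₑ ∂ν) + ∫⁻ y in symmDiff S' S'', ‖G'' y‖ₑ ∂ν := by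
  rw [← integral_indicator hS', ← integral_indicator hS'',
    ← integral_sub ((integrable_indicator_iff hS').2 h') ((integrable_indicator_iff hS'').2 h''),
    ← lintegral_indicator hS', ← lintegral_indicator (hS'.symmDiff hS''), ← lintegral_add_left']
  · refine (enorm_integral_le_lintegral_enorm _).trans (lintegral_mono fun y => ?_)
    by_cases h1 : y ∈ S' <;> by_cases h2 : y ∈ S'' <;> simp [h1, h2, Set.mem_symmDiff, indicator]
    calc ‖G' y‖ₑ = ‖(G' y - G'' y) + G'' y‖ₑ := by rw [sub_add_cancel]
      _ ≤ _ := enorm_add_le _ _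
  · exact ((hm'.sub hm'').enorm).indicator hS'

theorem aux_sumann {Y : Type*} [MeasurableSpace Y] (ν : Measure Y) (S : ℝ → Set Y)
    (hS : ∀ u, MeasurableSet (S u)) (hmono : Monotone S) (h : Y → ℝ≥0∞) (N : ℕ) (t : ℕ → ℝ)
    (ht : ∀ n, n < N → t n < t (n + 1)) :
    ∑ n ∈ Finset.range N, ∫⁻ y in S (t (n + 1)) \ S (t n), h y ∂ν ≤ ∫⁻ y, h y ∂ν := by
  have key : ∀ M ≤ N, t 0 ≤ t M ∧
      ∑ n ∈ Finset.range M, ∫⁻ y in S (t (n + 1)) \ S (t n), h y ∂ν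
        ≤ ∫⁻ y in S (t M) \ S (t 0), h y ∂ν := by
    intro M
    induction M with
    | zero => simp
    | succ M ih =>
      intro hM
      obtain ⟨h1, h2⟩ := ih (by omega)
      have h3 := ht M (by omega)
      refine ⟨by linarith, ?_⟩
      rw [Finset.sum_range_succ]
      refine (add_le_add h2 le_rfl).trans ?_
      rw [← lintegral_union ((hS _).diff (hS _))]
      · refine lintegral_mono_set ?_
        have a1 := hmono h1
        have a2 := hmono h3.le
        rintro y (⟨hy, hy'⟩ | ⟨hy, hy'⟩)
        · exact ⟨a2 hy, hy'⟩
        · exact ⟨hy, fun h => hy' (a1 h)⟩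
      · exact Set.disjoint_left.2 fun y hy hy' => hy'.2 hy.1
  exact (key N le_rfl).2.trans (setLIntegral_le_lintegral _ _)

theorem aux_shellHolder (μ : Measure X) (D A : ℝ) (hD : 0 < D) (hA : 0 < A)
    (hvol : ∀ (x : X) (R : ℝ), 0 < R → μ (ball x R) = ENNReal.ofReal (A * R ^ D)) :
    ∃ C : ℝ≥0, ∀ (z : X) (t : ℝ), 0 < t → ∀ p ∈ ball z t, ∀ φ : X → ℝ≥0∞, AEMeasurable φ μ →
      ∀ (u : ℝ) (E : Set X), MeasurableSet E →
      E ⊆ (ball z (3 * t))ᶜ ∩ {y | |dist p y - u| ≤ 2 * t} →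
      ∫⁻ y in E, ENNReal.ofReal (dist z y ^ (-D)) * φ y ∂μ ≤
        C * (∫⁻ y in E, ENNReal.ofReal (wt D (1 / 3) t z y) * φ y ^ (4 / 3 : ℝ) ∂μ) ^ (3 / 4 : ℝ) := by
  obtain ⟨C, hC⟩ := aux_shell μ D A hD hA hvol
  refine ⟨C ^ (1 / 4 : ℝ), ?_⟩
  intro z t ht p hp φ hφ u E hE hEs
  have hmw : Measurable fun y => wt D (1 / 3) t z y := by unfold wt; fun_prop
  refine (aux_holder (μ.restrict E) φ _ (fun y => ENNReal.ofReal (wt D (1 / 3) t z y))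
    (fun y => ENNReal.ofReal (dist z y ^ (-D) * (dist z y / t))) hφ.restrict
    (by fun_prop) (by fun_prop) ?_).trans ?_
  · refine (ae_restrict_iff' hE).2 (Eventually.of_forall fun y hy => ?_)
    have h1 := (hEs hy).1
    simp only [mem_compl_iff, mem_ball, not_lt, dist_comm y z] at h1
    have h0 : 0 < dist z y := by linarith
    rw [ENNReal.ofReal_rpow_of_nonneg (by unfold wt; positivity) (by norm_num),
      ENNReal.ofReal_rpow_of_nonneg (by positivity) (by norm_num), ← ENNReal.ofReal_mul (by unfold wt; positivity)]
    refine ENNReal.ofReal_le_ofReal (le_of_eq ?_)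
    unfold wt
    rw [Real.mul_rpow (by positivity) (by positivity), Real.mul_rpow (by positivity) (by positivity),
      ← Real.rpow_mul (by positivity), ← Real.rpow_mul (by positivity), ← Real.rpow_mul (by positivity)]
    have e1 : (t / dist z y) ^ (1 / 3 * (3 / 4) : ℝ) * (dist z y / t) ^ (1 / 4 : ℝ) = 1 := by
      rw [show (1 / 3 * (3 / 4) : ℝ) = 1 / 4 by norm_num, ← Real.mul_rpow (by positivity) (by positivity)]
      rw [show t / dist z y * (dist z y / t) = 1 by field_simp, Real.one_rpow]
    have e2 : dist z y ^ (-D * (3 / 4)) * dist z y ^ (-D * (1 / 4)) = dist z y ^ (-D) := by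
      rw [← Real.rpow_add h0]; ring_nf
    rw [← e2]
    linear_combination (-(dist z y ^ (-D * (3 / 4)) * dist z y ^ (-D * (1 / 4)))) * e1
  · rw [mul_comm]
    gcongr
    rw [ENNReal.coe_rpow_of_nonneg _ (by norm_num)]
    gcongr
    exact (lintegral_mono_set hEs).trans (hC z t ht p hp u)

theorem aux_annSum (μ : Measure X) (D A : ℝ) (hD : 0 < D) (hA : 0 < A)
    (hvol : ∀ (x : X) (R : ℝ), 0 < R → μ (ball x R) = ENNReal.ofReal (A * R ^ D)) :
    ∃ C : ℝ≥0, ∀ (z : X) (t : ℝ), 0 < t → ∀ p ∈ ball z t, ∀ φ : X → ℝ≥0∞, AEMeasurable φ μ →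
      ∀ (S' S'' : ℝ → Set X), (∀ u, MeasurableSet (S' u)) → (∀ u, MeasurableSet (S'' u)) →
      Monotone S' → Monotone S'' →
      (∀ u, symmDiff (S' u) (S'' u) ⊆ {y | |dist p y - u| ≤ 2 * t}) →
      ∀ (N : ℕ) (s : ℕ → ℝ), (∀ n, n < N → s n < s (n + 1)) →
      ∑ n ∈ Finset.range N, (∫⁻ y in (ball z (3 * t))ᶜ ∩
          symmDiff (S' (s (n + 1)) \ S' (s n)) (S'' (s (n + 1)) \ S'' (s n)),
        ENNReal.ofReal (dist z y ^ (-D)) * φ y ∂μ) ^ (4 / 3 : ℝ) ≤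
      (C * (∫⁻ y in (ball z (3 * t))ᶜ,
        ENNReal.ofReal (wt D (1 / 3) t z y) * φ y ^ (4 / 3 : ℝ) ∂μ) ^ (3 / 4 : ℝ)) ^ (4 / 3 : ℝ) := by
  obtain ⟨C, hC⟩ := aux_shellHolder μ D A hD hA hvol
  refine ⟨2 * (2 * C), ?_⟩
  intro z t ht p hp φ hφ S' S'' hm' hm'' hmono' hmono'' hsub N s hs
  set Ω := (ball z (3 * t))ᶜ with hΩ
  have hΩm : MeasurableSet Ω := measurableSet_ball.compl
  set g : X → ℝ≥0∞ := fun y => ENNReal.ofReal (wt D (1 / 3) t z y) * φ y ^ (4 / 3 : ℝ) with hg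
  set E : ℕ → Set X := fun n => Ω ∩
          symmDiff (S' (s (n + 1)) \ S' (s n)) (S'' (s (n + 1)) \ S'' (s n)) with hE
  have hEm : ∀ n, MeasurableSet (E n) := fun n =>
    hΩm.inter (((hm' _).diff (hm' _)).symmDiff ((hm'' _).diff (hm'' _)))
  have hshm : ∀ u, MeasurableSet (symmDiff (S' u) (S'' u)) := fun u => (hm' u).symmDiff (hm'' u)
  have h1 : ∀ n, ∫⁻ y in E n, ENNReal.ofReal (dist z y ^ (-D)) * φ y ∂μ ≤
      (2 * C) * (∫⁻ y in E n, g y ∂μ) ^ (3 / 4 : ℝ) := by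
    intro n
    have hcov : E n ⊆ (E n ∩ symmDiff (S' (s n)) (S'' (s n))) ∪
        (E n ∩ symmDiff (S' (s (n + 1))) (S'' (s (n + 1)))) := by
      rintro y hy
      have h2 := hy.2
      simp only [Set.mem_symmDiff, Set.mem_sdiff, mem_union, mem_inter_iff, hy, true_and] at h2 ⊢
      tauto
    have hone : ∀ u, ∫⁻ y in E n ∩ symmDiff (S' u) (S'' u), ENNReal.ofReal (dist z y ^ (-D)) * φ y ∂μ
        ≤ C * (∫⁻ y in E n, g y ∂μ) ^ (3 / 4 : ℝ) := by
      intro u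
      refine (hC z t ht p hp φ hφ u _ ((hEm n).inter (hshm u))
        (fun y hy => ⟨hy.1.1, hsub u hy.2⟩)).trans ?_
      gcongr
      exact inter_subset_left
    calc _ ≤ _ := lintegral_mono_set hcov
      _ ≤ _ := lintegral_union_le _ _ _
      _ ≤ C * (∫⁻ y in E n, g y ∂μ) ^ (3 / 4 : ℝ) + C * (∫⁻ y in E n, g y ∂μ) ^ (3 / 4 : ℝ) :=
          add_le_add (hone _) (hone _)
      _ = _ := by ring
  have h2 : ∑ n ∈ Finset.range N, ∫⁻ y in E n, g y ∂μ ≤ 2 * ∫⁻ y in Ω, g y ∂μ := by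
    calc _ ≤ ∑ n ∈ Finset.range N, ((∫⁻ y in S' (s (n + 1)) \ S' (s n), g y ∂(μ.restrict Ω))
            + ∫⁻ y in S'' (s (n + 1)) \ S'' (s n), g y ∂(μ.restrict Ω)) := by
          refine Finset.sum_le_sum fun n _ => ?_
          rw [Measure.restrict_restrict ((hm' _).diff (hm' _)),
            Measure.restrict_restrict ((hm'' _).diff (hm'' _))]
          refine (lintegral_mono_set ?_).trans (lintegral_union_le _ _ _)
          rintro y ⟨ha, hb⟩
          rcases hb with hb | hb
          · exact Or.inl ⟨hb.1, ha⟩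
          · exact Or.inr ⟨hb.1, ha⟩
      _ ≤ (∫⁻ y in Ω, g y ∂μ) + ∫⁻ y in Ω, g y ∂μ := by
          rw [Finset.sum_add_distrib]
          exact add_le_add (aux_sumann _ S' hm' hmono' g N s hs) (aux_sumann _ S'' hm'' hmono'' g N s hs)
      _ = _ := by ring
  calc _ ≤ ∑ n ∈ Finset.range N, (2 * C : ℝ≥0∞) ^ (4 / 3 : ℝ) * ∫⁻ y in E n, g y ∂μ := by
        refine Finset.sum_le_sum fun n _ => ?_
        refine (ENNReal.rpow_le_rpow (h1 n) (by norm_num)).trans (le_of_eq ?_)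
        rw [ENNReal.mul_rpow_of_nonneg _ _ (by norm_num), ← ENNReal.rpow_mul]
        norm_num
    _ ≤ (2 * C : ℝ≥0∞) ^ (4 / 3 : ℝ) * (2 * ∫⁻ y in Ω, g y ∂μ) := by
        rw [← Finset.mul_sum]; gcongr
    _ ≤ (2 * C : ℝ≥0∞) ^ (4 / 3 : ℝ) * (2 ^ (4 / 3 : ℝ) * ∫⁻ y in Ω, g y ∂μ) := by
        gcongr
        conv_lhs => rw [← ENNReal.rpow_one 2]
        exact ENNReal.rpow_le_rpow_of_exponent_le (by norm_num) (by norm_num)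
    _ = _ := by
        push_cast
        rw [ENNReal.mul_rpow_of_nonneg _ (_ ^ (3 / 4 : ℝ)) (by norm_num), ← ENNReal.rpow_mul,
          ENNReal.mul_rpow_of_nonneg 2 (2 * C : ℝ≥0∞) (by norm_num)]
        rw [show (3 / 4 * (4 / 3) : ℝ) = 1 by norm_num, ENNReal.rpow_one]
        ring

theorem aux_P (μ : Measure X) (D A : ℝ) (hD : 0 < D) (hA : 0 < A)
    (hvol : ∀ (x : X) (R : ℝ), 0 < R → μ (ball x R) = ENNReal.ofReal (A * R ^ D))
    (β : ℝ) (hβ : 0 < β) : ∃ C : ℝ≥0, ∀ (z : X) (t : ℝ), 0 < t → ∀ x ∈ ball z t,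
      ∀ (φ : X → ℝ≥0∞) (m : ℝ≥0∞), AEMeasurable φ μ →
      (∀ R > 0, ∫⁻ y in ball x R, φ y ^ (4 / 3 : ℝ) ∂μ ≤ m * μ (ball x R)) →
      ∫⁻ y in (ball z (3 * t))ᶜ, ENNReal.ofReal (wt D β t z y) * φ y ∂μ ≤ C * m ^ (3 / 4 : ℝ) := by
  obtain ⟨C, hC⟩ := aux_weight μ D A hD hA hvol β hβ
  refine ⟨C, ?_⟩
  intro z t ht x hx φ m hφ hm
  have hmw : Measurable fun y => wt D β t z y := by unfold wt; fun_prop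
  have h1 := hC z t ht x hx _ m hm
  have h2 := hC z t ht x hx (fun _ => 1) 1 (by intro R hR; simp)
  simp only [mul_one] at h2
  calc _ ≤ _ := aux_holder _ φ _ (fun y => ENNReal.ofReal (wt D β t z y))
        (fun y => ENNReal.ofReal (wt D β t z y)) hφ.restrict (by fun_prop) (by fun_prop)
        (Eventually.of_forall fun y => by
          rw [← ENNReal.rpow_add_of_nonneg _ _ (by norm_num) (by norm_num)]; norm_num)
    _ ≤ (C * m) ^ (3 / 4 : ℝ) * (C : ℝ≥0∞) ^ (1 / 4 : ℝ) := by gcongr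
    _ = _ := by
        rw [ENNReal.mul_rpow_of_nonneg _ _ (by norm_num), mul_right_comm,
          ← ENNReal.rpow_add_of_nonneg _ _ (by norm_num) (by norm_num)]
        norm_num

theorem aux_geom {z x' y : X} {t : ℝ} (hx' : x' ∈ ball z t)
    (hy : y ∈ (ball z (3 * t))ᶜ) : 3 * t ≤ dist z y ∧ 2 / 3 * dist z y ≤ dist x' y := by
  simp only [mem_compl_iff, mem_ball, not_lt, dist_comm y z] at hy
  rw [mem_ball] at hx'
  have := dist_triangle z x' y
  rw [dist_comm z x'] at this
  exact ⟨hy, by linarith⟩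

theorem aux_powbound {D ρ d : ℝ} (hD : 0 < D) (hρ : 0 < ρ) (h : 2 / 3 * ρ ≤ d) :
    d ^ (-D) ≤ (2 / 3) ^ (-D) * ρ ^ (-D) := by
  rw [← Real.mul_rpow (by norm_num) hρ.le]
  exact Real.rpow_le_rpow_of_nonpos (by positivity) h (by linarith)

theorem aux_K {D α : ℝ} (hD : 0 < D) (hα : 0 < α) {K : X → X → ℂ} (hK : IsAlphaKernel D α K)
    {z x' x'' y : X} {t : ℝ} (ht : 0 < t) (hx' : x' ∈ ball z t) (hx'' : x'' ∈ ball z t)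
    (hy : y ∈ (ball z (3 * t))ᶜ) :
    ‖K x' y - K x'' y‖ ≤ 2 * 5 ^ α * (2 / 3) ^ (-D) * wt D α t z y := by
  obtain ⟨-, hK1, hK2⟩ := hK
  obtain ⟨h1, h2⟩ := aux_geom hx' hy
  obtain ⟨-, h3⟩ := aux_geom hx'' hy
  have hρ : 0 < dist z y := by linarith
  have hd : dist x' x'' < 2 * t := by
    have := dist_triangle x' z x''
    rw [mem_ball] at hx' hx''
    rw [dist_comm z x''] at this
    linarith
  have b1 := aux_powbound hD hρ h2
  have b2 := aux_powbound hD hρ h3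
  rcases le_or_gt (2 * dist x' x'') (dist y x') with hc | hc
  · have h4 := hK2 y x' x'' hc
    have h5 : ‖K x' y - K x'' y‖ ≤ (dist x' x'' / dist y x') ^ α * dist y x' ^ (-D) := by
      linarith [norm_nonneg (K y x' - K y x'')]
    rw [dist_comm y x'] at h5
    have h6 : dist x' x'' / dist x' y ≤ 5 * (t / dist z y) := by
      have : 0 < dist x' y := by linarith
      rw [← mul_div_assoc, div_le_div_iff₀ this hρ]
      nlinarith
    have h7 : (dist x' x'' / dist x' y) ^ α ≤ 5 ^ α * (t / dist z y) ^ α := by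
      rw [← Real.mul_rpow (by norm_num) (by positivity)]
      exact Real.rpow_le_rpow (by positivity) h6 hα.le
    calc _ ≤ _ := h5
      _ ≤ (5 ^ α * (t / dist z y) ^ α) * ((2 / 3) ^ (-D) * dist z y ^ (-D)) := by gcongr
      _ ≤ 2 * ((5 ^ α * (t / dist z y) ^ α) * ((2 / 3) ^ (-D) * dist z y ^ (-D))) :=
          le_mul_of_one_le_left (by positivity) (by norm_num)
      _ = _ := by unfold wt; ring
  · have hne' : x' ≠ y := by rw [← dist_pos]; linarith
    have hne'' : x'' ≠ y := by rw [← dist_pos]; linarith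
    have h4 := hK1 x' y hne'
    have h5 := hK1 x'' y hne''
    have h6 : 1 ≤ 5 ^ α * (t / dist z y) ^ α := by
      rw [← Real.mul_rpow (by norm_num) (by positivity)]
      refine Real.one_le_rpow ?_ hα.le
      rw [← mul_div_assoc, one_le_div hρ]
      rw [dist_comm y x'] at hc
      have h7 := dist_triangle z x' y
      rw [mem_ball, dist_comm] at hx'
      linarith
    calc _ ≤ ‖K x' y‖ + ‖K x'' y‖ := norm_sub_le _ _
      _ ≤ 2 * ((2 / 3) ^ (-D) * dist z y ^ (-D)) * 1 := by linarith
      _ ≤ 2 * ((2 / 3) ^ (-D) * dist z y ^ (-D)) * (5 ^ α * (t / dist z y) ^ α) := by gcongr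
      _ = _ := by unfold wt; ring

theorem aux_locint (μ : Measure X) (D A : ℝ)
    (hvol : ∀ (x : X) (R : ℝ), 0 < R → μ (ball x R) = ENNReal.ofReal (A * R ^ D))
    (f : X → ℂ) (hf : AEStronglyMeasurable f μ) (x : X) (m : ℝ≥0∞) (hm0 : m ≠ ⊤)
    (hm : ∀ R > 0, ∫⁻ y in ball x R, ‖f y‖ₑ ^ (4 / 3 : ℝ) ∂μ ≤ m * μ (ball x R))
    (R : ℝ) (hR : 0 < R) : IntegrableOn f (ball x R) μ := by
  refine ⟨hf.restrict, ?_⟩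
  have hfin : μ (ball x R) ≠ ⊤ := by rw [hvol _ _ hR]; exact ENNReal.ofReal_ne_top
  calc ∫⁻ y in ball x R, ‖f y‖ₑ ∂μ ≤ ∫⁻ y in ball x R, (1 + ‖f y‖ₑ ^ (4 / 3 : ℝ)) ∂μ := by
        refine lintegral_mono fun y => ?_
        rcases le_total ‖f y‖ₑ 1 with h | h
        · exact h.trans le_self_add
        · refine le_trans ?_ le_add_self
          conv_lhs => rw [← ENNReal.rpow_one ‖f y‖ₑ]
          exact ENNReal.rpow_le_rpow_of_exponent_le h (by norm_num)
    _ = μ (ball x R) + ∫⁻ y in ball x R, ‖f y‖ₑ ^ (4 / 3 : ℝ) ∂μ := by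
        rw [lintegral_add_left measurable_const]; simp
    _ ≤ μ (ball x R) + m * μ (ball x R) := by gcongr; exact hm R hR
    _ < ⊤ := ENNReal.add_lt_top.2 ⟨hfin.lt_top, ENNReal.mul_lt_top hm0.lt_top hfin.lt_top⟩

theorem expi_norm (s : ℝ) : ‖expi s‖ = 1 := by
  unfold expi; exact Complex.norm_exp_ofReal_mul_I s

theorem expi_enorm (s : ℝ) : ‖expi s‖ₑ = 1 := by
  rw [← ofReal_norm, expi_norm]; simp

theorem expi_cont : Continuous expi := by unfold expi; fun_prop

theorem aux_main_b (μ : Measure X) (D A : ℝ) (hD : 0 < D) (hA : 0 < A)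
    (hvol : ∀ (x : X) (R : ℝ), 0 < R → μ (ball x R) = ENNReal.ofReal (A * R ^ D))
    (α : ℝ) (hα : 0 < α) (K : X → X → ℂ) (hK : IsAlphaKernel D α K)
    (r : ℝ) (hr : 2 < r) :
    ∃ C : ℝ≥0, ∀ f : X → ℂ, AEStronglyMeasurable f μ → ∀ (x : X) (m : ℝ≥0∞), m ≠ ⊤ →
      (∀ R > 0, ∫⁻ y in ball x R, ‖f y‖ₑ ^ (4 / 3 : ℝ) ∂μ ≤ m * μ (ball x R)) →
      ∀ (z : X) (t : ℝ), 0 < t → x ∈ ball z t → ∀ x' ∈ ball z t, ∀ x'' ∈ ball z t,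
      ∀ Q : X → ℝ, Continuous Q →
      ‖singOp μ K 1 Q ((ball z (3 * t))ᶜ.indicator f) x'
        - singOp μ K 1 Q ((ball z (3 * t))ᶜ.indicator f) x''‖ₑ +
      vNorm r (Set.Ioi 0) (fun u => singOp μ K u Q ((ball z (3 * t))ᶜ.indicator f) x'
        - singOp μ K u Q ((ball z (3 * t))ᶜ.indicator f) x'') ≤ C * m ^ (3 / 4 : ℝ) := by
  obtain ⟨CP, hCP⟩ := aux_P μ D A hD hA hvol α hα
  obtain ⟨CW, hCW⟩ := aux_weight μ D A hD hA hvol (1 / 3) (by norm_num)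
  obtain ⟨CS, hCS⟩ := aux_shellHolder μ D A hD hA hvol
  obtain ⟨CN, hCN⟩ := aux_annSum μ D A hD hA hvol
  set c1 : ℝ≥0 := ((2 / 3 : ℝ) ^ (-D)).toNNReal with hc1
  set c2 : ℝ≥0 := (2 * 5 ^ α * (2 / 3 : ℝ) ^ (-D)).toNNReal with hc2
  refine ⟨(c2 * CP + c1 * (CS * CW ^ (3 / 4 : ℝ))) + (c2 * CP + c1 * (CN * CW ^ (3 / 4 : ℝ))), ?_⟩
  intro f hf x m hm0 hm z t ht hx x' hx' x'' hx'' Q hQ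
  set Ω := (ball z (3 * t))ᶜ with hΩ
  have hΩm : MeasurableSet Ω := measurableSet_ball.compl
  set φ : X → ℝ≥0∞ := fun y => ‖f y‖ₑ with hφ
  have hφm : AEMeasurable φ μ := hf.enorm
  set G : X → X → ℂ := fun w y => K w y * Ω.indicator f y * expi (Q y) with hG
  have hKm : ∀ w, Measurable (K w) := fun w => hK.1.comp measurable_prodMk_left
  have hGm : ∀ w, AEStronglyMeasurable (G w) μ := fun w =>
    ((hKm w).aestronglyMeasurable.mul (hf.indicator hΩm)).mul
      (expi_cont.comp hQ).measurable.aestronglyMeasurable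
  set P := ∫⁻ y in Ω, ENNReal.ofReal (wt D α t z y) * φ y ∂μ with hP
  set W := ∫⁻ y in Ω, ENNReal.ofReal (wt D (1 / 3) t z y) * φ y ^ (4 / 3 : ℝ) ∂μ with hW
  have hPle : P ≤ CP * m ^ (3 / 4 : ℝ) := hCP z t ht x hx φ m hφm hm
  have hWle : W ^ (3 / 4 : ℝ) ≤ (CW ^ (3 / 4 : ℝ) : ℝ≥0) * m ^ (3 / 4 : ℝ) := by
    rw [ENNReal.coe_rpow_of_nonneg _ (by norm_num), ← ENNReal.mul_rpow_of_nonneg _ _ (by norm_num)]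
    exact ENNReal.rpow_le_rpow (hCW z t ht x hx _ m hm) (by norm_num)
  -- pointwise bounds
  have hGdiff : ∀ y, ‖G x' y - G x'' y‖ₑ ≤
      Ω.indicator (fun y => c2 * (ENNReal.ofReal (wt D α t z y) * φ y)) y := by
    intro y
    by_cases hy : y ∈ Ω
    · rw [indicator_of_mem hy]
      simp only [hG, indicator_of_mem hy]
      rw [← sub_mul, ← sub_mul, enorm_mul, enorm_mul, expi_enorm, mul_one, ← mul_assoc]
      gcongr
      rw [← ofReal_norm, hc2, ← ENNReal.ofReal, ← ENNReal.ofReal_mul (by positivity)]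
      exact ENNReal.ofReal_le_ofReal (aux_K hD hα hK ht hx' hx'' hy)
    · simp [hG, hy]
  have hGb : ∀ w ∈ ball z t, ∀ y, ‖G w y‖ₑ ≤
      Ω.indicator (fun y => c1 * (ENNReal.ofReal (dist z y ^ (-D)) * φ y)) y := by
    intro w hw y
    by_cases hy : y ∈ Ω
    · rw [indicator_of_mem hy]
      simp only [hG, indicator_of_mem hy]
      rw [enorm_mul, enorm_mul, expi_enorm, mul_one, ← mul_assoc]
      gcongr
      rw [← ofReal_norm, hc1, ← ENNReal.ofReal, ← ENNReal.ofReal_mul (by positivity)]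
      obtain ⟨h1, h2⟩ := aux_geom hw hy
      refine ENNReal.ofReal_le_ofReal ((hK.2.1 w y (by rw [← dist_pos]; linarith)).trans ?_)
      exact aux_powbound hD (by linarith) h2
    · simp [hG, hy]
  have hGloc : ∀ w ∈ ball z t, ∀ R > 0, IntegrableOn (G w) (ball x R) μ := by
    intro w hw R hR
    have h1 := (aux_locint μ D A hvol f hf x m hm0 hm R hR).norm.const_mul ((2 * t) ^ (-D))
    refine Integrable.mono' h1 (hGm w).restrict (Eventually.of_forall fun y => ?_)
    by_cases hy : y ∈ Ω
    · simp only [hG, indicator_of_mem hy, norm_mul, expi_norm, mul_one]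
      gcongr
      obtain ⟨h1, h2⟩ := aux_geom hw hy
      refine (hK.2.1 w y (by rw [← dist_pos]; linarith)).trans ?_
      exact Real.rpow_le_rpow_of_nonpos (by positivity) (by linarith) (by linarith)
    · simp only [hG, indicator_of_notMem hy]
      simp; positivity
  have hPtop : P < ⊤ := hPle.trans_lt
    (ENNReal.mul_lt_top ENNReal.coe_lt_top (ENNReal.rpow_lt_top_of_nonneg (by norm_num) hm0))
  have hint_diff : Integrable (fun y => G x' y - G x'' y) μ := by
    refine ⟨(hGm x').sub (hGm x''), ?_⟩
    refine (lintegral_mono hGdiff).trans_lt ?_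
    rw [lintegral_indicator hΩm, lintegral_const_mul' _ _ ENNReal.coe_ne_top]
    exact ENNReal.mul_lt_top ENNReal.coe_lt_top hPtop
  set S : X → ℝ → Set X := fun w u => {y | dist w y ≤ u} with hS
  have hSm : ∀ w u, MeasurableSet (S w u) := fun w u => measurableSet_le (by fun_prop) (by fun_prop)
  have hSmono : ∀ w, Monotone (S w) := fun w a b hab y hy => le_trans (α := ℝ) hy hab
  have hsing : ∀ w u, singOp μ K u Q (Ω.indicator f) w = ∫ y in (S w u)ᶜ, G w y ∂μ := by
    intro w u
    have : {y | u < dist w y} = (S w u)ᶜ := by ext y; simp [hS]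
    unfold singOp
    rw [this]
  have hiff : ∀ w ∈ ball z t, ∀ u > 0, IntegrableOn (G w) (S w u)ᶜ μ → Integrable (G w) μ := by
    intro w hw u hu hi
    rw [← integrableOn_univ, ← compl_union_self (S w u)]
    refine hi.union ((hGloc w hw (u + 2 * t) (by positivity)).mono_set fun y hy => ?_)
    have h1 : dist w y ≤ u := hy
    have h2 := dist_triangle y w x
    have h3 := dist_triangle w z x
    rw [mem_ball] at hw hx ⊢
    rw [dist_comm y w] at h2
    rw [dist_comm z x] at h3
    linarith
  have hsymm : ∀ u, symmDiff (S x' u) (S x'' u) ⊆ {y | |dist x' y - u| ≤ 2 * t} := by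
    intro u y hy
    have hd : dist x' x'' < 2 * t := by
      have := dist_triangle x' z x''
      rw [mem_ball] at hx' hx''
      rw [dist_comm z x''] at this
      linarith
    have h1 := dist_triangle x' x'' y
    have h2 := dist_triangle x'' x' y
    rw [dist_comm x'' x'] at h2
    simp only [Set.mem_symmDiff, hS, mem_ofPred_eq, not_le] at hy
    simp only [mem_ofPred_eq, abs_le]
    rcases hy with ⟨h3, h4⟩ | ⟨h3, h4⟩ <;> constructor <;> linarith
  have hinc : Integrable (G x') μ → Integrable (G x'') μ → ∀ B' B'' : Set X, MeasurableSet B' →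
      MeasurableSet B'' → ‖(∫ y in B', G x' y ∂μ) - ∫ y in B'', G x'' y ∂μ‖ₑ ≤
        c2 * (∫⁻ y in B', ENNReal.ofReal (wt D α t z y) * φ y ∂(μ.restrict Ω)) +
        c1 * ∫⁻ y in Ω ∩ symmDiff B' B'', ENNReal.ofReal (dist z y ^ (-D)) * φ y ∂μ := by
    intro hi' hi'' B' B'' hB' hB''
    refine (aux_intdiff μ (G x') (G x'') B' B'' hB' hB'' (hGm _) (hGm _) hi'.integrableOn
      hi''.integrableOn).trans (add_le_add ?_ ?_)
    · refine (lintegral_mono hGdiff).trans (le_of_eq ?_)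
      rw [lintegral_indicator hΩm, lintegral_const_mul' _ _ ENNReal.coe_ne_top,
        Measure.restrict_restrict hΩm, Measure.restrict_restrict hB', inter_comm]
    · refine (lintegral_mono (hGb x'' hx'')).trans (le_of_eq ?_)
      rw [lintegral_indicator hΩm, lintegral_const_mul' _ _ ENNReal.coe_ne_top,
        Measure.restrict_restrict hΩm]
  have hcases : (Integrable (G x') μ ∧ Integrable (G x'') μ) ∨
      (∀ u > 0, singOp μ K u Q (Ω.indicator f) x' - singOp μ K u Q (Ω.indicator f) x'' = 0) := by
    by_cases h1 : Integrable (G x') μ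
    · left
      refine ⟨h1, ?_⟩
      have := h1.sub hint_diff
      refine this.congr (Eventually.of_forall fun y => ?_)
      simp
    · right
      have h2 : ¬ Integrable (G x'') μ := by
        intro h2
        apply h1
        refine (h2.add hint_diff).congr (Eventually.of_forall fun y => ?_)
        simp
      intro u hu
      rw [hsing, hsing, integral_undef (fun h => h1 (hiff x' hx' u hu h)),
        integral_undef (fun h => h2 (hiff x'' hx'' u hu h)), sub_zero]
  have hfirst : ‖singOp μ K 1 Q (Ω.indicator f) x' - singOp μ K 1 Q (Ω.indicator f) x''‖ₑ ≤
      (c2 * CP + c1 * (CS * CW ^ (3 / 4 : ℝ)) : ℝ≥0) * m ^ (3 / 4 : ℝ) := by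
    rcases hcases with ⟨hi', hi''⟩ | h0
    · rw [hsing, hsing]
      refine (hinc hi' hi'' _ _ (hSm _ _).compl (hSm _ _).compl).trans ?_
      push_cast
      rw [add_mul, mul_assoc, mul_assoc, mul_assoc]
      gcongr
      · exact (setLIntegral_le_lintegral _ _).trans hPle
      · rw [compl_symmDiff_compl]
        refine (hCS z t ht x' hx' φ hφm 1 _ (hΩm.inter ((hSm _ _).symmDiff (hSm _ _)))
          (inter_subset_inter_right _ (hsymm 1))).trans ?_
        gcongr
        refine le_trans ?_ hWle
        gcongr
        exact lintegral_mono_set inter_subset_left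
    · rw [h0 1 one_pos]; simp
  have hsecond : vNorm r (Set.Ioi 0) (fun u => singOp μ K u Q (Ω.indicator f) x'
        - singOp μ K u Q (Ω.indicator f) x'') ≤ c2 * P + c1 * (CN * W ^ (3 / 4 : ℝ)) := by
    refine aux_vnorm hr _ _ _ fun N s hs0 hs => ?_
    refine ⟨fun n => c2 * (∫⁻ y in S x' (s (n + 1)) \ S x' (s n),
        ENNReal.ofReal (wt D α t z y) * φ y ∂(μ.restrict Ω)),
      fun n => c1 * ∫⁻ y in Ω ∩ symmDiff (S x' (s (n + 1)) \ S x' (s n))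
        (S x'' (s (n + 1)) \ S x'' (s n)), ENNReal.ofReal (dist z y ^ (-D)) * φ y ∂μ, ?_, ?_, ?_⟩
    · intro n hn
      rcases hcases with ⟨hi', hi''⟩ | h0
      · refine le_trans (le_of_eq ?_) (hinc hi' hi'' _ _ ((hSm _ _).diff (hSm _ _))
          ((hSm _ _).diff (hSm _ _)))
        have hsplit : ∀ w, Integrable (G w) μ → (∫ y in (S w (s n))ᶜ, G w y ∂μ) =
            (∫ y in (S w (s (n + 1)))ᶜ, G w y ∂μ) + ∫ y in S w (s (n + 1)) \ S w (s n), G w y ∂μ := by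
          intro w hw
          rw [← setIntegral_union _ ((hSm _ _).diff (hSm _ _)) hw.integrableOn hw.integrableOn]
          · congr 2
            have := hSmono w (hs n hn).le
            ext y
            by_cases h1 : y ∈ S w (s n)
            · have := this h1; simp [h1, this]
            · by_cases h2 : y ∈ S w (s (n + 1)) <;> simp [h1, h2]
          · exact Set.disjoint_left.2 fun y hy hy' => hy hy'.1
        simp only [hsing]
        rw [hsplit x' hi', hsplit x'' hi'', ← enorm_neg]
        congr 1
        ring
      · simp only [h0 _ (hs0 n hn.le), h0 _ (hs0 (n + 1) hn)]
        simp
    · rw [← Finset.mul_sum]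
      gcongr
      exact aux_sumann (μ.restrict Ω) (S x') (hSm x') (hSmono x') _ N s hs
    · simp_rw [ENNReal.mul_rpow_of_nonneg (c1 : ℝ≥0∞) _ (show (0:ℝ) ≤ 4 / 3 by norm_num)]
      rw [← Finset.mul_sum]
      gcongr
      exact hCN z t ht x' hx' φ hφm (S x') (S x'') (hSm x') (hSm x'') (hSmono x') (hSmono x'')
        hsymm N s hs
  rw [ENNReal.coe_add, add_mul]
  refine add_le_add hfirst (hsecond.trans ?_)
  push_cast
  rw [add_mul, mul_assoc, mul_assoc, mul_assoc]
  gcongr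

theorem aux_psi {D T a b : ℝ} (hD : 0 < D) (hT : 0 < T) (ha : T < a) (hab : a < b) :
    (1 - (a / b) ^ D) * (T / a) ^ (1 / 8 : ℝ) ≤
      max 1 (8 * D) * ((T / max a T) ^ (1 / 8 : ℝ) - (T / max b T) ^ (1 / 8 : ℝ)) := by
  have ha0 : 0 < a := by linarith
  have hb0 : 0 < b := by linarith
  rw [max_eq_left ha.le, max_eq_left (by linarith : T ≤ b)]
  have h1 := aux_bern (x := (a / b) ^ (1 / 8 : ℝ)) (p := 8 * D) (by positivity)
    (Real.rpow_le_one (by positivity) ((div_le_one hb0).2 hab.le) (by norm_num)) (by linarith)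
  rw [← Real.rpow_mul (by positivity), show 1 / 8 * (8 * D) = D by ring] at h1
  have h2 : (T / b) ^ (1 / 8 : ℝ) = (a / b) ^ (1 / 8 : ℝ) * (T / a) ^ (1 / 8 : ℝ) := by
    rw [← Real.mul_rpow (by positivity) (by positivity)]
    congr 1; field_simp
  rw [h2]
  calc _ ≤ max 1 (8 * D) * (1 - (a / b) ^ (1 / 8 : ℝ)) * (T / a) ^ (1 / 8 : ℝ) := by gcongr
    _ = _ := by ring

theorem aux_psi_anti {T a b : ℝ} (hT : 0 < T) (hab : a ≤ b) :
    (T / max b T) ^ (1 / 8 : ℝ) ≤ (T / max a T) ^ (1 / 8 : ℝ) := by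
  have : 0 < max a T := lt_max_of_lt_right hT
  have : 0 < max b T := lt_max_of_lt_right hT
  have : max a T ≤ max b T := max_le_max_right _ hab
  exact Real.rpow_le_rpow (by positivity) (by gcongr) (by norm_num)

theorem aux_psi_one {T a : ℝ} (hT : 0 < T) :
    (T / max a T) ^ (1 / 8 : ℝ) ≤ 1 := by
  have : 0 < max a T := lt_max_of_lt_right hT
  exact Real.rpow_le_one (by positivity) ((div_le_one this).2 (le_max_right _ _)) (by norm_num)

theorem aux_main_a (μ : Measure X) (D A : ℝ) (hD : 0 < D) (hA : 0 < A)
    (hvol : ∀ (x : X) (R : ℝ), 0 < R → μ (ball x R) = ENNReal.ofReal (A * R ^ D))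
    (r : ℝ) (hr : 2 < r) :
    ∃ C : ℝ≥0, ∀ f : X → ℂ, AEStronglyMeasurable f μ → ∀ (x : X) (m : ℝ≥0∞), m ≠ ⊤ →
      (∀ R > 0, ∫⁻ y in ball x R, ‖f y‖ₑ ^ (4 / 3 : ℝ) ∂μ ≤ m * μ (ball x R)) →
      ∀ (z : X) (t : ℝ), 0 < t → x ∈ ball z t → ∀ x' ∈ ball z t, ∀ x'' ∈ ball z t,
      ∀ Q : X → ℝ, Continuous Q →
      ‖avgOp μ 1 Q ((ball z (3 * t))ᶜ.indicator f) x'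
        - avgOp μ 1 Q ((ball z (3 * t))ᶜ.indicator f) x''‖ₑ +
      vNorm r (Set.Ioi 0) (fun u => avgOp μ u Q ((ball z (3 * t))ᶜ.indicator f) x'
        - avgOp μ u Q ((ball z (3 * t))ᶜ.indicator f) x'') ≤ C * m ^ (3 / 4 : ℝ) := by
  obtain ⟨CW, hCW⟩ := aux_weight μ D A hD hA hvol (1 / 3) (by norm_num)
  obtain ⟨CV, hCV⟩ := aux_weight μ D A hD hA hvol (1 / 6) (by norm_num)
  obtain ⟨CS, hCS⟩ := aux_shellHolder μ D A hD hA hvol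
  obtain ⟨CN, hCN⟩ := aux_annSum μ D A hD hA hvol
  set c1 : ℝ≥0 := ((2 / 3 : ℝ) ^ (-D)).toNNReal with hc1
  set cA : ℝ≥0 := (A⁻¹).toNNReal with hcA
  set κ : ℝ≥0 := (max 1 (8 * D)).toNNReal with hκ
  refine ⟨cA * (c1 * (CS * CV ^ (3 / 4 : ℝ))) + (cA * (κ * (c1 * (CS * CV ^ (3 / 4 : ℝ))))
    + cA * (c1 * (CN * CW ^ (3 / 4 : ℝ)))), ?_⟩
  intro f hf x m hm0 hm z t ht hx x' hx' x'' hx'' Q hQ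
  set Ω := (ball z (3 * t))ᶜ with hΩ
  have hΩm : MeasurableSet Ω := measurableSet_ball.compl
  set φ : X → ℝ≥0∞ := fun y => ‖f y‖ₑ with hφ
  have hφm : AEMeasurable φ μ := hf.enorm
  set G : X → ℂ := fun y => Ω.indicator f y * expi (Q y) with hG
  have hGm : AEStronglyMeasurable G μ := (hf.indicator hΩm).mul
      (expi_cont.comp hQ).measurable.aestronglyMeasurable
  set W := ∫⁻ y in Ω, ENNReal.ofReal (wt D (1 / 3) t z y) * φ y ^ (4 / 3 : ℝ) ∂μ with hW
  set V := ∫⁻ y in Ω, ENNReal.ofReal (wt D (1 / 6) t z y) * φ y ^ (4 / 3 : ℝ) ∂μ with hV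
  have hWle : W ^ (3 / 4 : ℝ) ≤ (CW ^ (3 / 4 : ℝ) : ℝ≥0) * m ^ (3 / 4 : ℝ) := by
    rw [ENNReal.coe_rpow_of_nonneg _ (by norm_num), ← ENNReal.mul_rpow_of_nonneg _ _ (by norm_num)]
    exact ENNReal.rpow_le_rpow (hCW z t ht x hx _ m hm) (by norm_num)
  have hVle : V ^ (3 / 4 : ℝ) ≤ (CV ^ (3 / 4 : ℝ) : ℝ≥0) * m ^ (3 / 4 : ℝ) := by
    rw [ENNReal.coe_rpow_of_nonneg _ (by norm_num), ← ENNReal.mul_rpow_of_nonneg _ _ (by norm_num)]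
    exact ENNReal.rpow_le_rpow (hCV z t ht x hx _ m hm) (by norm_num)
  have hGe : ∀ y, ‖G y‖ₑ = Ω.indicator φ y := by
    intro y
    by_cases hy : y ∈ Ω
    · simp [hG, hy, expi_enorm, hφ]
    · simp [hG, hy]
  have hGloc : ∀ R > 0, IntegrableOn G (ball x R) μ := by
    intro R hR
    refine (aux_locint μ D A hvol f hf x m hm0 hm R hR).norm.mono' hGm.restrict
      (Eventually.of_forall fun y => ?_)
    by_cases hy : y ∈ Ω
    · simp [hG, hy, expi_norm]
    · simp [hG, hy]
  set S : X → ℝ → Set X := fun w u => ball w u with hS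
  have hSm : ∀ w u, MeasurableSet (S w u) := fun w u => measurableSet_ball
  have hSmono : ∀ w, Monotone (S w) := fun w a b hab => ball_subset_ball hab
  have hGint : ∀ w ∈ ball z t, ∀ u > 0, IntegrableOn G (S w u) μ := by
    intro w hw u hu
    refine (hGloc (u + 2 * t) (by positivity)).mono_set fun y hy => ?_
    have h1 : dist y w < u := hy
    have h2 := dist_triangle y w x
    have h3 := dist_triangle w z x
    rw [mem_ball] at hw hx ⊢
    rw [dist_comm z x] at h3
    linarith
  have hsymm : ∀ u, symmDiff (S x' u) (S x'' u) ⊆ {y | |dist x' y - u| ≤ 2 * t} := by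
    intro u y hy
    have hd : dist x' x'' < 2 * t := by
      have := dist_triangle x' z x''
      rw [mem_ball] at hx' hx''
      rw [dist_comm z x''] at this
      linarith
    have h1 := dist_triangle x' x'' y
    have h2 := dist_triangle x'' x' y
    rw [dist_comm x'' x'] at h2
    simp only [Set.mem_symmDiff, hS, mem_ball, not_lt, dist_comm y] at hy
    simp only [mem_ofPred_eq, abs_le]
    rcases hy with ⟨h3, h4⟩ | ⟨h3, h4⟩ <;> constructor <;> linarith
  -- difference of integrals over sets contained in balls of radius b
  have hinc : ∀ b > 0, ∀ B' B'' : Set X, MeasurableSet B' → MeasurableSet B'' →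
      B' ⊆ S x' b → B'' ⊆ S x'' b →
      ENNReal.ofReal (b ^ (-D)) * ‖(∫ y in B', G y ∂μ) - ∫ y in B'', G y ∂μ‖ₑ ≤
        c1 * ∫⁻ y in Ω ∩ symmDiff B' B'', ENNReal.ofReal (dist z y ^ (-D)) * φ y ∂μ := by
    intro b hb B' B'' hB' hB'' hs' hs''
    have h1 := aux_intdiff μ G G B' B'' hB' hB'' hGm hGm ((hGint x' hx' b hb).mono_set hs')
      ((hGint x'' hx'' b hb).mono_set hs'')
    simp only [sub_self, enorm_zero, lintegral_zero, zero_add, hGe] at h1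
    rw [lintegral_indicator hΩm, Measure.restrict_restrict hΩm] at h1
    calc _ ≤ ENNReal.ofReal (b ^ (-D)) * ∫⁻ y in Ω ∩ symmDiff B' B'', φ y ∂μ := by gcongr
      _ = ∫⁻ y in Ω ∩ symmDiff B' B'', ENNReal.ofReal (b ^ (-D)) * φ y ∂μ :=
          (lintegral_const_mul' _ _ ENNReal.ofReal_ne_top).symm
      _ ≤ ∫⁻ y in Ω ∩ symmDiff B' B'', c1 * (ENNReal.ofReal (dist z y ^ (-D)) * φ y) ∂μ := by
          refine setLIntegral_mono' (hΩm.inter (hB'.symmDiff hB'')) fun y hy => ?_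
          rw [← mul_assoc]
          gcongr
          rw [hc1, ← ENNReal.ofReal, ← ENNReal.ofReal_mul (by positivity)]
          refine ENNReal.ofReal_le_ofReal ?_
          obtain ⟨g1, g2⟩ := aux_geom hx' hy.1
          obtain ⟨-, g3⟩ := aux_geom hx'' hy.1
          refine aux_powbound hD (by linarith) ?_
          rcases hy.2 with h | h
          · have h5 : dist y x' < b := hs' h.1
            rw [dist_comm] at h5; linarith
          · have h5 : dist y x'' < b := hs'' h.1
            rw [dist_comm] at h5; linarith
      _ = _ := lintegral_const_mul' _ _ ENNReal.coe_ne_top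
  set H : ℝ → ℂ := fun u => (∫ y in S x' u, G y ∂μ) - ∫ y in S x'' u, G y ∂μ with hH
  set ψ : ℝ → ℝ := fun u => (2 * t / max u (2 * t)) ^ (1 / 8 : ℝ) with hψ
  have hT : 0 < 2 * t := by positivity
  have hψ0 : ∀ u, 0 ≤ ψ u := fun u => by
    have : 0 < max u (2 * t) := lt_max_of_lt_right hT
    simp only [hψ]; positivity
  have hH0 : ∀ a, 0 < a → a ≤ 2 * t → H a = 0 := by
    intro a ha0 ha
    have h1 : ∀ w ∈ ball z t, ∫ y in S w a, G y ∂μ = 0 := by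
      intro w hw
      refine setIntegral_eq_zero_of_forall_eq_zero fun y hy => ?_
      have hy' : y ∉ Ω := by
        intro hy'
        obtain ⟨g1, g2⟩ := aux_geom hw hy'
        have h5 : dist y w < a := hy
        rw [dist_comm] at h5; linarith
      simp [hG, hy']
    simp only [hH, h1 x' hx', h1 x'' hx'', sub_zero]
  have hHb : ∀ a, 2 * t < a → ENNReal.ofReal (a ^ (-D)) * ‖H a‖ₑ ≤
      ENNReal.ofReal ((2 * t / a) ^ (1 / 8 : ℝ)) * (c1 * (CS * V ^ (3 / 4 : ℝ))) := by
    intro a ha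
    have ha0 : 0 < a := by linarith
    refine (hinc a ha0 _ _ (hSm _ _) (hSm _ _) subset_rfl subset_rfl).trans ?_
    rw [mul_left_comm, mul_left_comm _ (CS : ℝ≥0∞)]
    gcongr
    refine (hCS z t ht x' hx' φ hφm a _ (hΩm.inter ((hSm _ _).symmDiff (hSm _ _)))
          (inter_subset_inter_right _ (hsymm a))).trans ?_
    gcongr
    have e1 : ENNReal.ofReal ((2 * t / a) ^ (1 / 8 : ℝ)) =
        ENNReal.ofReal ((2 * t / a) ^ (1 / 6 : ℝ)) ^ (3 / 4 : ℝ) := by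
      rw [ENNReal.ofReal_rpow_of_nonneg (by positivity) (by norm_num), ← Real.rpow_mul (by positivity)]
      norm_num
    rw [e1, ← ENNReal.mul_rpow_of_nonneg _ _ (by norm_num)]
    refine ENNReal.rpow_le_rpow ?_ (by norm_num)
    calc _ ≤ ∫⁻ y in Ω ∩ symmDiff (S x' a) (S x'' a), ENNReal.ofReal ((2 * t / a) ^ (1 / 6 : ℝ)) *
          (ENNReal.ofReal (wt D (1 / 6) t z y) * φ y ^ (4 / 3 : ℝ)) ∂μ := by
          refine setLIntegral_mono' (hΩm.inter ((hSm _ _).symmDiff (hSm _ _))) fun y hy => ?_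
          rw [← mul_assoc]
          gcongr
          rw [← ENNReal.ofReal_mul (by positivity)]
          refine ENNReal.ofReal_le_ofReal ?_
          obtain ⟨g1, g2⟩ := aux_geom hx' hy.1
          have g3 := hsymm a hy.2
          simp only [mem_ofPred_eq, abs_le] at g3
          have hρ : 0 < dist z y := by linarith
          have g4 : a ≤ 2 * dist z y := by
            have := dist_triangle x' z y
            rw [mem_ball] at hx'
            linarith
          unfold wt
          rw [← mul_assoc]
          gcongr
          rw [show (1 / 3 : ℝ) = 1 / 6 + 1 / 6 by norm_num, Real.rpow_add (by positivity)]
          gcongr ?_ * _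
          refine Real.rpow_le_rpow (by positivity) ?_ (by norm_num)
          rw [div_le_div_iff₀ hρ ha0]
          nlinarith
      _ = ENNReal.ofReal ((2 * t / a) ^ (1 / 6 : ℝ)) * ∫⁻ y in Ω ∩ symmDiff (S x' a) (S x'' a),
          (ENNReal.ofReal (wt D (1 / 6) t z y) * φ y ^ (4 / 3 : ℝ)) ∂μ :=
          lintegral_const_mul' _ _ ENNReal.ofReal_ne_top
      _ ≤ _ := by
          gcongr
          exact lintegral_mono_set inter_subset_left
  have havg : ∀ u > 0, avgOp μ u Q (Ω.indicator f) x' - avgOp μ u Q (Ω.indicator f) x'' =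
      ((A⁻¹ * u ^ (-D) : ℝ) : ℂ) * H u := by
    intro u hu
    have e : (ENNReal.ofReal (A * u ^ D)).toReal⁻¹ = A⁻¹ * u ^ (-D) := by
      rw [ENNReal.toReal_ofReal (by positivity), mul_inv, Real.rpow_neg hu.le]
    unfold avgOp
    rw [hvol _ _ hu, hvol _ _ hu, e, ← smul_sub, Complex.real_smul]
  have hcAe : ∀ v : ℝ, ‖((A⁻¹ * v : ℝ) : ℂ)‖ₑ = cA * ‖v‖ₑ := by
    intro v
    rw [← ofReal_norm, Complex.norm_real, norm_mul, Real.norm_of_nonneg (by positivity : 0 ≤ A⁻¹),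
      ENNReal.ofReal_mul (by positivity), ofReal_norm]
    rfl
  have hfirst : ‖avgOp μ 1 Q (Ω.indicator f) x' - avgOp μ 1 Q (Ω.indicator f) x''‖ₑ ≤
      cA * (c1 * (CS * V ^ (3 / 4 : ℝ))) := by
    rw [havg 1 one_pos, enorm_mul, hcAe, mul_assoc]
    refine mul_le_mul' le_rfl ?_
    rcases le_or_gt 1 (2 * t) with h | h
    · rw [hH0 1 one_pos h]; simp
    · rw [Real.enorm_of_nonneg (by positivity)]
      refine (hHb 1 h).trans ?_
      refine mul_le_of_le_one_left' ?_
      rw [ENNReal.ofReal_le_one]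
      exact Real.rpow_le_one (by positivity) (by rw [div_one]; exact h.le) (by norm_num)
  have hsecond : vNorm r (Set.Ioi 0) (fun u => avgOp μ u Q (Ω.indicator f) x'
        - avgOp μ u Q (Ω.indicator f) x'') ≤
      cA * (κ * (c1 * (CS * V ^ (3 / 4 : ℝ)))) + (cA * c1) * (CN * W ^ (3 / 4 : ℝ)) := by
    refine aux_vnorm hr _ _ _ fun N s hs0 hs => ?_
    refine ⟨fun n => ENNReal.ofReal (ψ (s n) - ψ (s (n + 1))) *
        (cA * (κ * (c1 * (CS * V ^ (3 / 4 : ℝ))))),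
      fun n => (cA * c1) * ∫⁻ y in Ω ∩ symmDiff (S x' (s (n + 1)) \ S x' (s n))
        (S x'' (s (n + 1)) \ S x'' (s n)), ENNReal.ofReal (dist z y ^ (-D)) * φ y ∂μ, ?_, ?_, ?_⟩
    · intro n hn
      have ha0 := hs0 n hn.le
      have hb0 := hs0 (n + 1) hn
      have hab := hs n hn
      set a := s n
      set b := s (n + 1)
      simp only [havg a ha0, havg b hb0]
      have e : ((A⁻¹ * b ^ (-D) : ℝ) : ℂ) * H b - ((A⁻¹ * a ^ (-D) : ℝ) : ℂ) * H a =
          ((A⁻¹ * (b ^ (-D) - a ^ (-D)) : ℝ) : ℂ) * H a + ((A⁻¹ * b ^ (-D) : ℝ) : ℂ) * (H b - H a) := by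
        push_cast; ring
      rw [e]
      refine (enorm_add_le _ _).trans (add_le_add ?_ ?_)
      · rw [enorm_mul, hcAe, mul_assoc, mul_left_comm _ (cA : ℝ≥0∞)]
        refine mul_le_mul' le_rfl ?_
        rcases le_or_gt a (2 * t) with h | h
        · rw [hH0 a ha0 h]; simp
        · have h1 := hHb a h
          have e2 : ‖b ^ (-D) - a ^ (-D)‖ₑ =
              ENNReal.ofReal (1 - (a / b) ^ D) * ENNReal.ofReal (a ^ (-D)) := by
            have hle : b ^ (-D) ≤ a ^ (-D) := Real.rpow_le_rpow_of_nonpos ha0 hab.le (by linarith)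
            have hr1 : (a / b) ^ D ≤ 1 :=
              Real.rpow_le_one (by positivity) ((div_le_one hb0).2 hab.le) hD.le
            rw [← ofReal_norm, Real.norm_of_nonpos (by linarith), ← ENNReal.ofReal_mul (by linarith)]
            congr 1
            rw [Real.div_rpow ha0.le hb0.le, Real.rpow_neg ha0.le, Real.rpow_neg hb0.le]
            have : a ^ D ≠ 0 := by positivity
            have : b ^ D ≠ 0 := by positivity
            field_simp
            ring
          rw [e2, mul_assoc]
          calc _ ≤ ENNReal.ofReal (1 - (a / b) ^ D) * (ENNReal.ofReal ((2 * t / a) ^ (1 / 8 : ℝ)) *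
                (c1 * (CS * V ^ (3 / 4 : ℝ)))) := by gcongr
            _ = ENNReal.ofReal ((1 - (a / b) ^ D) * (2 * t / a) ^ (1 / 8 : ℝ)) *
                (c1 * (CS * V ^ (3 / 4 : ℝ))) := by
                rw [← mul_assoc, ENNReal.ofReal_mul' (by positivity)]
            _ ≤ ENNReal.ofReal (max 1 (8 * D) * (ψ a - ψ b)) * (c1 * (CS * V ^ (3 / 4 : ℝ))) := by
                exact mul_le_mul' (ENNReal.ofReal_le_ofReal (aux_psi hD hT h hab)) le_rfl
            _ = _ := by
                rw [ENNReal.ofReal_mul (by positivity), mul_comm (ENNReal.ofReal (max 1 (8 * D))),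
                  mul_assoc]
                rfl
      · rw [enorm_mul, hcAe, mul_assoc, mul_assoc, Real.enorm_of_nonneg (by positivity)]
        refine mul_le_mul' le_rfl ?_
        have hsplit : ∀ w ∈ ball z t, (∫ y in S w b, G y ∂μ) - (∫ y in S w a, G y ∂μ) =
            ∫ y in S w b \ S w a, G y ∂μ := by
          intro w hw
          rw [setIntegral_sdiff (hSm _ _) (hGint w hw b hb0) (hSmono w hab.le)]
        have e3 : H b - H a = (∫ y in S x' b \ S x' a, G y ∂μ) - ∫ y in S x'' b \ S x'' a, G y ∂μ := by
          rw [← hsplit x' hx', ← hsplit x'' hx'']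
          simp only [hH]; ring
        rw [e3]
        exact hinc b hb0 _ _ ((hSm _ _).diff (hSm _ _)) ((hSm _ _).diff (hSm _ _))
          sdiff_subset sdiff_subset
    · rw [← Finset.sum_mul]
      refine mul_le_of_le_one_left' ?_
      rw [← ENNReal.ofReal_sum_of_nonneg (fun n hn => sub_nonneg.2
        (aux_psi_anti hT (hs n (Finset.mem_range.1 hn)).le)), Finset.sum_range_sub',
        ENNReal.ofReal_le_one]
      have h1 : ψ (s 0) ≤ 1 := aux_psi_one hT
      linarith [hψ0 (s N)]
    · simp_rw [ENNReal.mul_rpow_of_nonneg (cA * c1 : ℝ≥0∞) _ (show (0:ℝ) ≤ 4 / 3 by norm_num)]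
      rw [← Finset.mul_sum]
      gcongr
      exact hCN z t ht x' hx' φ hφm (S x') (S x'') (hSm x') (hSm x'') (hSmono x') (hSmono x'')
        hsymm N s hs
  refine (add_le_add hfirst hsecond).trans ?_
  simp only [ENNReal.coe_add, ENNReal.coe_mul, add_mul, mul_assoc]
  gcongr

theorem stmt15 (μ : Measure X) (D A : ℝ) (hD : 0 < D) (hA : 0 < A)
    (hvol : ∀ (x : X) (R : ℝ), 0 < R → μ (ball x R) = ENNReal.ofReal (A * R ^ D))
    (𝒬 : Set (X → ℝ)) (h𝒬 : ∀ Q ∈ 𝒬, Continuous Q)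
    (α : ℝ) (hα : 0 < α) (hα1 : α ≤ 1) (K : X → X → ℂ) (hK : IsAlphaKernel D α K)
    (r : ℝ) (hr : 2 < r) :
    ∃ C > 0, ∀ f : X → ℂ, LocallyIntegrable f μ → ∀ x : X,
      MTa μ 𝒬 r f x + MTb μ 𝒬 K r f x ≤
        ENNReal.ofReal C * maxFn μ (4 / 3) f x ^ (3 / 4 : ℝ) := by
  haveI : SecondCountableTopology X := aux_second μ D A hA hvol
  obtain ⟨Ca, hCa⟩ := aux_main_a μ D A hD hA hvol r hr
  obtain ⟨Cb, hCb⟩ := aux_main_b μ D A hD hA hvol α hα K hK r hr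
  refine ⟨Ca + Cb + 1, by positivity, ?_⟩
  intro f hf x
  have hfm : AEStronglyMeasurable f μ := hf.aestronglyMeasurable
  set m := maxFn μ (4 / 3) f x with hmdef
  have hCe : ENNReal.ofReal (Ca + Cb + 1 : ℝ) = Ca + Cb + 1 := by
    rw [ENNReal.ofReal_add (by positivity) zero_le_one, ENNReal.ofReal_add (by positivity) (by positivity)]
    simp
  rw [hCe]
  by_cases hm0 : m = ⊤
  · rw [hm0, ENNReal.top_rpow_of_pos (by norm_num), ENNReal.mul_top (by simp)]
    exact le_top
  have hm : ∀ R > 0, ∫⁻ y in ball x R, ‖f y‖ₑ ^ (4 / 3 : ℝ) ∂μ ≤ m * μ (ball x R) := by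
    intro R hR
    have h1 : (μ (ball x R))⁻¹ * ∫⁻ y in ball x R, ‖f y‖ₑ ^ (4 / 3 : ℝ) ∂μ ≤ m := by
      rw [hmdef]
      exact le_iSup₂_of_le (f := fun (R : ℝ) (_ : 0 < R) =>
        (μ (ball x R))⁻¹ * ∫⁻ y in ball x R, (‖f y‖₊ : ℝ≥0∞) ^ (4 / 3 : ℝ) ∂μ) R hR le_rfl
    have hne0 : μ (ball x R) ≠ 0 := by
      rw [hvol _ _ hR]; simp only [ne_eq, ENNReal.ofReal_eq_zero, not_le]; positivity
    have hnet : μ (ball x R) ≠ ⊤ := by rw [hvol _ _ hR]; exact ENNReal.ofReal_ne_top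
    calc _ = μ (ball x R) * ((μ (ball x R))⁻¹ * ∫⁻ y in ball x R, ‖f y‖ₑ ^ (4 / 3 : ℝ) ∂μ) := by
          rw [← mul_assoc, ENNReal.mul_inv_cancel hne0 hnet, one_mul]
      _ ≤ μ (ball x R) * m := by gcongr
      _ = _ := mul_comm _ _
  have ha : MTa μ 𝒬 r f x ≤ Ca * m ^ (3 / 4 : ℝ) := by
    unfold MTa
    refine iSup_le fun z => iSup_le fun t => iSup_le fun ht => iSup_le fun hx => iSup_le fun x' =>
      iSup_le fun hx' => iSup_le fun x'' => iSup_le fun hx'' => iSup_le fun Q => iSup_le fun hQ => ?_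
    exact hCa f hfm x m hm0 hm z t ht hx x' hx' x'' hx'' Q (h𝒬 Q hQ)
  have hb : MTb μ 𝒬 K r f x ≤ Cb * m ^ (3 / 4 : ℝ) := by
    unfold MTb
    refine iSup_le fun z => iSup_le fun t => iSup_le fun ht => iSup_le fun hx => iSup_le fun x' =>
      iSup_le fun hx' => iSup_le fun x'' => iSup_le fun hx'' => iSup_le fun Q => iSup_le fun hQ => ?_
    exact hCb f hfm x m hm0 hm z t ht hx x' hx' x'' hx'' Q (h𝒬 Q hQ)
  calc _ ≤ _ := add_le_add ha hb
    _ = (Ca + Cb) * m ^ (3 / 4 : ℝ) := by ring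
    _ ≤ _ := mul_le_mul' le_self_add le_rfl

end
end
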